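/- arXiv:2112.07741 — 13 statements merged into one kernel-verified Lean document; each statement's English description precedes it below -/
import Mathlib

section
/- For every game matrix k : Fin n_A → Fin n_B → ZMod d (with n_A, n_B ≥ 2) the contradiction number satisfies β_C(k) ≤ (n_A − 1)(n_B − 1); equivalently, the classical value p_Cl(k) = 1 − β_C(k)/(n_A·n_B) satisfies p_Cl(k) ≥ (n_A + n_B − 1)/(n_A·n_B). -/
/-- The number of contradictions of the classical strategy `(a, b)` for the game matrix `k`. -/
def numContr {nA nB d : ℕ} (k : Fin nA → Fin nB → ZMod d)
    (a : Fin nA → ZMod d) (b : Fin nB → ZMod d) : ℕ :=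
  ((Finset.univ : Finset (Fin nA × Fin nB)).filter
    (fun p => b p.2 ≠ a p.1 + k p.1 p.2)).card

/-- The contradiction number `β_C(k)`: the minimum number of contradictions over all
classical strategies. -/
noncomputable def betaC {nA nB d : ℕ} (k : Fin nA → Fin nB → ZMod d) : ℕ :=
  sInf { m | ∃ (a : Fin nA → ZMod d) (b : Fin nB → ZMod d), numContr k a b = m }

theorem betaC_le_numContr {nA nB d : ℕ} (k : Fin nA → Fin nB → ZMod d)
    (a : Fin nA → ZMod d) (b : Fin nB → ZMod d) : betaC k ≤ numContr k a b :=
  Nat.sInf_le ⟨a, b, rfl⟩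

/-- Some classical strategy has at most `(n_A − 1)(n_B − 1)` contradictions: the one which satisfies
every constraint in the row of `x₀` and the column of `y₀`. -/
theorem exists_numContr_le {nA nB d : ℕ} (k : Fin nA → Fin nB → ZMod d)
    (x₀ : Fin nA) (y₀ : Fin nB) :
    ∃ (a : Fin nA → ZMod d) (b : Fin nB → ZMod d), numContr k a b ≤ (nA - 1) * (nB - 1) := by
  refine ⟨fun x => k x₀ y₀ - k x y₀, fun y => k x₀ y, ?_⟩
  calc numContr k (fun x => k x₀ y₀ - k x y₀) (fun y => k x₀ y)
      ≤ (Finset.univ.erase x₀ ×ˢ Finset.univ.erase y₀).card := by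
        refine Finset.card_le_card fun p hp => ?_
        simp only [Finset.mem_filter, Finset.mem_univ, true_and] at hp
        simp only [Finset.mem_product, Finset.mem_erase, Finset.mem_univ, and_true]
        constructor <;> intro h <;> simp [h] at hp
    _ = (nA - 1) * (nB - 1) := by simp [Finset.card_product]

/-- The contradiction number of an `n_A × n_B` game matrix is at most
`(n_A − 1)(n_B − 1)`; equivalently the classical value
`p_Cl = 1 − β_C/(n_A n_B)` is at least `(n_A + n_B − 1)/(n_A n_B)`. -/
theorem betaC_le_max {nA nB d : ℕ} (hA : 2 ≤ nA) (hB : 2 ≤ nB) (hd : 1 ≤ d)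
    (k : Fin nA → Fin nB → ZMod d) :
    betaC k ≤ (nA - 1) * (nB - 1) ∧
    ((nA : ℝ) + (nB : ℝ) - 1) / ((nA : ℝ) * (nB : ℝ)) ≤
      1 - (betaC k : ℝ) / ((nA : ℝ) * (nB : ℝ)) := by
  have hbeta : betaC k ≤ (nA - 1) * (nB - 1) := by
    obtain ⟨a, b, h⟩ := exists_numContr_le k ⟨0, by omega⟩ ⟨0, by omega⟩
    exact (betaC_le_numContr k a b).trans h
  refine ⟨hbeta, ?_⟩
  have hcast : (betaC k : ℝ) ≤ ((nA : ℝ) - 1) * ((nB : ℝ) - 1) := by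
    rw [← Nat.cast_pred (by omega), ← Nat.cast_pred (by omega)]
    exact_mod_cast hbeta
  have hpos : (0 : ℝ) < (nA : ℝ) * (nB : ℝ) := by
    have : 0 < nA * nB := Nat.mul_pos (by omega) (by omega)
    exact_mod_cast this
  rw [div_le_iff₀ hpos, sub_mul, div_mul_cancel₀ _ hpos.ne']
  linarith
end

section
/- Let n ≥ 4 and let k : Fin n → Fin n → ZMod d be a game matrix with k(i,j) = 0 whenever i ≠ j (all off-diagonal entries are zero). Then the contradiction number of k equals the number of nonzero diagonal entries: β_C(k) = #{i : k(i,i) ≠ 0}. -/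
open Finset in
/-- The number of elements different from two distinct ones. -/
theorem sum_indicator_distinct {ι : Type*} [Fintype ι] [DecidableEq ι] (p q : ι) :
    (∑ r : ι, if p ≠ q ∧ p ≠ r ∧ q ≠ r then 1 else 0) =
      if p ≠ q then Fintype.card ι - 2 else 0 := by
  by_cases h : p = q
  · simp [h]
  · have hset : (univ.filter fun r : ι => p ≠ r ∧ q ≠ r) = ({p, q} : Finset ι)ᶜ := by
      ext r
      simp [eq_comm]
    simp only [ne_eq, h, not_false_eq_true, true_and, if_true]
    rw [← card_filter, hset, card_compl, card_pair h]

open Finset in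
/-- Among the pairs `(x, y)` with `a x ≠ b y`, at least as many are off the diagonal as on it.
Each `i` with `a i ≠ b i` and each ordered pair of further indices `x, y` force one of
`(i, y)`, `(x, y)`, `(x, i)` to be such a pair; the bound follows by double counting. -/
theorem sum_diagonal_ne_le_sum_offDiagonal_ne {ι α : Type*} [Fintype ι] [DecidableEq ι]
    [DecidableEq α] (hι : 4 ≤ Fintype.card ι) (a b : ι → α) :
    (∑ i, if a i ≠ b i then 1 else 0) ≤
      ∑ x, ∑ y, if x ≠ y ∧ a x ≠ b y then 1 else 0 := by
  set N := Fintype.card ι with hN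
  set E : ι → ℕ := fun i => if a i ≠ b i then 1 else 0 with hE
  set B : ι → ι → ℕ := fun x y => if x ≠ y ∧ a x ≠ b y then 1 else 0 with hB
  let T : ι → ι → ι → ℕ := fun p q r => if p ≠ q ∧ p ≠ r ∧ q ≠ r then 1 else 0
  have hT : ∀ p q, ∑ r, T p q r = if p ≠ q then N - 2 else 0 := sum_indicator_distinct
  have hT₁ : ∀ p q r, T p q r = T p r q := by
    intro p q r
    simp only [T]
    congr 1
    grind
  have hT₂ : ∀ p q r, T p q r = T q r p := by
    intro p q r
    simp only [T]
    congr 1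
    grind
  have hBT : ∀ p q, (∑ r, T p q r) * B p q = (N - 2) * B p q := by
    intro p q
    rw [hT]
    by_cases h : p = q <;> simp [hB, h]
  have hpt : ∀ i x y, T i x y * E i ≤ T i x y * B i y + T i x y * B x y + T i x y * B x i := by
    intro i x y
    simp only [T, hE, hB]
    split_ifs <;> grind
  have hleft : ∑ i, ∑ x, ∑ y, T i x y * E i = (N - 2) * ((N - 1) * ∑ i, E i) := by
    rw [mul_sum, mul_sum]
    refine sum_congr rfl fun i _ => ?_
    simp_rw [← sum_mul, hT]
    rw [← sum_filter, sum_const, filter_ne, card_erase_of_mem (mem_univ i), card_univ, ← hN,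
      smul_eq_mul]
    ring
  have h₁ : ∑ i, ∑ x, ∑ y, T i x y * B i y = (N - 2) * ∑ x, ∑ y, B x y := by
    simp_rw [mul_sum, ← hBT]
    refine sum_congr rfl fun i _ => ?_
    rw [sum_comm]
    refine sum_congr rfl fun y _ => ?_
    rw [sum_mul]
    exact sum_congr rfl fun x _ => by rw [hT₁]
  have h₂ : ∑ i, ∑ x, ∑ y, T i x y * B x y = (N - 2) * ∑ x, ∑ y, B x y := by
    simp_rw [mul_sum, ← hBT]
    rw [sum_comm]
    refine sum_congr rfl fun x _ => ?_
    rw [sum_comm]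
    refine sum_congr rfl fun y _ => ?_
    rw [sum_mul]
    exact sum_congr rfl fun i _ => by rw [hT₂]
  have h₃ : ∑ i, ∑ x, ∑ y, T i x y * B x i = (N - 2) * ∑ x, ∑ y, B x y := by
    simp_rw [mul_sum, ← hBT]
    rw [sum_comm]
    refine sum_congr rfl fun x _ => ?_
    refine sum_congr rfl fun i _ => ?_
    rw [sum_mul]
    exact sum_congr rfl fun y _ => by rw [hT₂, hT₁]
  have key : (N - 2) * ((N - 1) * ∑ i, E i) ≤ (N - 2) * (3 * ∑ x, ∑ y, B x y) := by
    calc (N - 2) * ((N - 1) * ∑ i, E i)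
        ≤ ∑ i, ∑ x, ∑ y, (T i x y * B i y + T i x y * B x y + T i x y * B x i) := by
          rw [← hleft]
          exact sum_le_sum fun i _ => sum_le_sum fun x _ => sum_le_sum fun y _ => hpt i x y
      _ = (N - 2) * (3 * ∑ x, ∑ y, B x y) := by
          simp_rw [sum_add_distrib]
          rw [h₁, h₂, h₃]
          ring
  have hcancel := Nat.le_of_mul_le_mul_left key (by omega)
  have hthree : 3 * ∑ i, E i ≤ (N - 1) * ∑ i, E i := Nat.mul_le_mul_right _ (by omega)
  change ∑ i, E i ≤ ∑ x, ∑ y, B x y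
  omega

/-- The strategy `(0, 0)` has one contradiction for each nonzero entry of a diagonal matrix. -/
theorem numContr_zero_of_diagonal {n d : ℕ} (k : Fin n → Fin n → ZMod d)
    (hoff : ∀ i j : Fin n, i ≠ j → k i j = 0) :
    numContr k 0 0 = ((Finset.univ : Finset (Fin n)).filter (fun i => k i i ≠ 0)).card := by
  symm
  refine Finset.card_bij (fun i _ => (i, i)) ?_ ?_ ?_
  · intro i hi
    simpa [eq_comm] using hi
  · intro i _ j _ h
    exact congrArg Prod.fst h
  · rintro ⟨x, y⟩ h
    have hk : k x y ≠ 0 := by simpa [eq_comm] using h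
    obtain rfl : x = y := by
      by_contra hxy
      exact hk (hoff x y hxy)
    exact ⟨x, by simpa using hk, rfl⟩

open Finset in
/-- Every strategy has at least as many contradictions as a diagonal matrix of size at least four
has nonzero entries. -/
theorem card_diagonal_ne_zero_le_numContr {n d : ℕ} (hn : 4 ≤ n) (k : Fin n → Fin n → ZMod d)
    (hoff : ∀ i j : Fin n, i ≠ j → k i j = 0) (a b : Fin n → ZMod d) :
    ((univ : Finset (Fin n)).filter (fun i => k i i ≠ 0)).card ≤ numContr k a b := by
  have hsplit : numContr k a b =
      (∑ x, ∑ y, if x ≠ y ∧ a x ≠ b y then 1 else 0) +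
        ∑ i, if b i ≠ a i + k i i then 1 else 0 := by
    rw [numContr, card_filter, Fintype.sum_prod_type, ← sum_add_distrib]
    refine sum_congr rfl fun x _ => ?_
    rw [← Fintype.sum_ite_eq x (fun y => if b y ≠ a y + k y y then 1 else 0), ← sum_add_distrib]
    refine sum_congr rfl fun y _ => ?_
    by_cases hxy : x = y
    · subst hxy
      simp
    · simp [hxy, hoff x y hxy, eq_comm]
  rw [hsplit, card_filter]
  calc (∑ i, if k i i ≠ 0 then 1 else 0)
      ≤ ∑ i, ((if a i ≠ b i then 1 else 0) + if b i ≠ a i + k i i then 1 else 0) := by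
        refine sum_le_sum fun i _ => ?_
        by_cases h : a i = b i
        · simp [h]
        · simp only [ne_eq, h, not_false_eq_true, if_true]
          split_ifs <;> omega
    _ ≤ _ := by
        rw [sum_add_distrib]
        exact Nat.add_le_add_right
          (sum_diagonal_ne_le_sum_offDiagonal_ne (by simpa using hn) a b) _

/-- For `n ≥ 4`, a diagonal game matrix (all off-diagonal entries zero) has contradiction
number equal to the number of nonzero diagonal entries. -/
theorem betaC_diagonal {n d : ℕ} (hn : 4 ≤ n) (hd : 1 ≤ d)
    (k : Fin n → Fin n → ZMod d)
    (hoff : ∀ i j : Fin n, i ≠ j → k i j = 0) :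
    betaC k = ((Finset.univ : Finset (Fin n)).filter (fun i => k i i ≠ 0)).card := by
  apply le_antisymm
  · exact Nat.sInf_le ⟨0, 0, numContr_zero_of_diagonal k hoff⟩
  · refine le_csInf ⟨_, 0, 0, rfl⟩ ?_
    rintro m ⟨a, b, rfl⟩
    exact card_diagonal_ne_zero_le_numContr hn k hoff a b
end

section
/- Let k : Fin n_A → Fin n_B → ZMod d (with n_A, n_B ≥ 2) be a game matrix all of whose entries are zero except possibly those in the last row, whose entries are m_1, …, m_{n_B} ∈ ZMod d. Let t be the maximal multiplicity of a value in the last row, i.e. t = max over v ∈ ZMod d of #{j : m_j = v}. Then β_C(k) = n_B − t. -/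
/-- Every column in which rows `i` and `i'` are incompatible with the strategy contains a
contradiction. -/
theorem card_filter_sub_ne_le_numContr {nA nB d : ℕ} (k : Fin nA → Fin nB → ZMod d)
    (a : Fin nA → ZMod d) (b : Fin nB → ZMod d) (i i' : Fin nA) :
    ((Finset.univ : Finset (Fin nB)).filter
      (fun j => ¬ k i' j - k i j = a i - a i')).card ≤ numContr k a b := by
  classical
  refine le_trans (Finset.card_le_card ?_) (Finset.card_image_le (f := Prod.snd))
  intro j hj
  rw [Finset.mem_filter] at hj
  rw [Finset.mem_image]
  by_cases h : b j = a i + k i j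
  · refine ⟨(i', j), ?_, rfl⟩
    rw [Finset.mem_filter]
    refine ⟨Finset.mem_univ _, fun h' => hj.2 ?_⟩
    linear_combination h - h'
  · exact ⟨(i, j), by simpa using h, rfl⟩

/-- If all rows other than `l` vanish, some strategy has contradictions only in the entries of
row `l` that differ from `v`. -/
theorem exists_numContr_le_card_filter_ne {nA nB d : ℕ} (k : Fin nA → Fin nB → ZMod d)
    (l : Fin nA) (hzero : ∀ i j, i ≠ l → k i j = 0) (v : ZMod d) :
    ∃ a b, numContr k a b ≤
      ((Finset.univ : Finset (Fin nB)).filter (fun j => ¬ k l j = v)).card := by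
  classical
  refine ⟨fun i => if i = l then -v else 0, fun _ => 0, ?_⟩
  refine le_trans (Finset.card_le_card ?_) (Finset.card_image_le (f := fun j => (l, j)))
  rintro ⟨i, j⟩ hp
  rw [Finset.mem_filter] at hp
  by_cases h : i = l
  · subst h
    refine Finset.mem_image.2 ⟨j, ?_, rfl⟩
    rw [Finset.mem_filter]
    refine ⟨Finset.mem_univ _, fun h' => hp.2 ?_⟩
    simp [h']
  · exact absurd (by simp [h, hzero i j h]) hp.2

/-- If all entries of a game matrix are zero except possibly those in the last row, and `t`
is the maximal multiplicity of a value in the last row, then `β_C(k) = n_B − t`. -/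
theorem betaC_last_row {nA nB d : ℕ} (hA : 2 ≤ nA) (hB : 2 ≤ nB) (hd : 1 ≤ d)
    (k : Fin nA → Fin nB → ZMod d)
    (hzero : ∀ (i : Fin nA) (j : Fin nB), (i : ℕ) ≠ nA - 1 → k i j = 0)
    (t : ℕ)
    (ht_attained : ∃ v : ZMod d,
      t = ((Finset.univ : Finset (Fin nB)).filter
        (fun j => k ⟨nA - 1, by omega⟩ j = v)).card)
    (ht_max : ∀ v : ZMod d,
      ((Finset.univ : Finset (Fin nB)).filter
        (fun j => k ⟨nA - 1, by omega⟩ j = v)).card ≤ t) :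
    betaC k = nB - t := by
  have hcompl : ∀ v : ZMod d,
      ((Finset.univ : Finset (Fin nB)).filter
        (fun j => k ⟨nA - 1, by omega⟩ j = v)).card +
      ((Finset.univ : Finset (Fin nB)).filter
        (fun j => ¬ k ⟨nA - 1, by omega⟩ j = v)).card = nB := fun v => by
    simpa using Finset.card_filter_add_card_filter_not (s := (Finset.univ : Finset (Fin nB)))
      (fun j => k ⟨nA - 1, by omega⟩ j = v)
  apply le_antisymm
  · obtain ⟨v, hv⟩ := ht_attained
    obtain ⟨a, b, hab⟩ := exists_numContr_le_card_filter_ne k ⟨nA - 1, by omega⟩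
      (fun i j hi => hzero i j fun h => hi (Fin.ext h)) v
    have hle : betaC k ≤ numContr k a b := Nat.sInf_le ⟨a, b, rfl⟩
    have := hcompl v
    omega
  · refine le_csInf ⟨_, 0, 0, rfl⟩ ?_
    rintro _ ⟨a, b, rfl⟩
    have hle := card_filter_sub_ne_le_numContr k a b ⟨0, by omega⟩ ⟨nA - 1, by omega⟩
    have h0 : ∀ j, k ⟨0, by omega⟩ j = 0 := fun j => hzero _ j (by simp; omega)
    simp only [h0, sub_zero] at hle
    have := hcompl (a ⟨0, by omega⟩ - a ⟨nA - 1, by omega⟩)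
    have := ht_max (a ⟨0, by omega⟩ - a ⟨nA - 1, by omega⟩)
    omega
end

section
/- Let k : Fin n_A → Fin n_B → ZMod d be a game matrix, let 2 ≤ l, and let i₁,…,i_l be pairwise distinct rows and j₁,…,j_l pairwise distinct columns. Then the following are equivalent: (1) the cycle is good, i.e. k(i₁,j₁) + k(i₂,j₂) + ⋯ + k(i_l,j_l) = k(i₂,j₁) + k(i₃,j₂) + ⋯ + k(i₁,j_l) in ZMod d (indices of rows taken cyclically); (2) there exist functions η : Fin n_A → ZMod d and ξ : Fin n_B → ZMod d such that the matrix k'(x,y) = k(x,y) + η(x) + ξ(y) satisfies k'(i_t, j_t) = 0 and k'(i_{t+1}, j_t) = 0 for all t = 1,…,l (with i_{l+1} = i₁). -/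
/-- On a cycle of length `l`, a function into an abelian group is the difference between a
function and its cyclic shift as soon as its values sum to zero. -/
theorem exists_shift_sub_eq_of_sum_eq_zero {A : Type*} [AddCommGroup A] {l : ℕ} (hl : 2 ≤ l)
    (g : Fin l → A) (hg : ∑ t, g t = 0) :
    ∃ e : Fin l → A, ∀ t, e (t + ⟨1, by omega⟩) - e t = g t := by
  let G : ℕ → A := fun s => if h : s < l then g ⟨s, h⟩ else 0
  have hG (t : Fin l) : G t = g t := by simp [G]
  have hsum : ∑ s ∈ Finset.range l, G s = 0 := by
    rw [Finset.sum_range]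
    simpa only [hG] using hg
  refine ⟨fun t => ∑ s ∈ Finset.range t, G s, fun t => ?_⟩
  have hsucc := Finset.sum_range_succ G t
  rw [hG] at hsucc
  rcases (Nat.succ_le_of_lt t.isLt).lt_or_eq with h | h
  · have hval : (t + ⟨1, by omega⟩ : Fin l).val = t + 1 := by
      rw [Fin.val_add]
      exact Nat.mod_eq_of_lt h
    simp only [hval, hsucc, add_sub_cancel_left]
  · have hval : (t + ⟨1, by omega⟩ : Fin l).val = 0 := by
      rw [Fin.val_add]
      change (t.val + 1) % l = 0
      rw [← Nat.succ_eq_add_one, h, Nat.mod_self]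
    rw [← Nat.succ_eq_add_one, h, hsum] at hsucc
    simp only [hval, Finset.sum_range_zero, zero_sub]
    exact neg_eq_of_add_eq_zero_right hsucc.symm

/-- A cycle (given by pairwise distinct rows `i₁,…,i_l` and pairwise distinct columns
`j₁,…,j_l`, with row indices taken cyclically) is good, i.e.
`k(i₁,j₁) + ⋯ + k(i_l,j_l) = k(i₂,j₁) + ⋯ + k(i₁,j_l)`, if and only if there are row and
column shifts `η`, `ξ` making all entries of the cycle vanish. -/
theorem good_cycle_iff_shift {nA nB d : ℕ} (hA : 2 ≤ nA) (hB : 2 ≤ nB) (hd : 1 ≤ d)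
    (k : Fin nA → Fin nB → ZMod d) {l : ℕ} (hl : 2 ≤ l)
    (i : Fin l → Fin nA) (j : Fin l → Fin nB)
    (hi : Function.Injective i) (hj : Function.Injective j) :
    (∑ t : Fin l, k (i t) (j t) = ∑ t : Fin l, k (i (t + ⟨1, by omega⟩)) (j t)) ↔
    ∃ (η : Fin nA → ZMod d) (ξ : Fin nB → ZMod d),
      ∀ t : Fin l,
        k (i t) (j t) + η (i t) + ξ (j t) = 0 ∧
        k (i (t + ⟨1, by omega⟩)) (j t) + η (i (t + ⟨1, by omega⟩)) + ξ (j t) = 0 := by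
  constructor
  · intro h
    obtain ⟨e, he⟩ := exists_shift_sub_eq_of_sum_eq_zero hl
      (fun t => k (i t) (j t) - k (i (t + ⟨1, by omega⟩)) (j t))
      (by rw [Finset.sum_sub_distrib, h, sub_self])
    refine ⟨Function.extend i e 0,
      Function.extend j (fun t => -k (i t) (j t) - e t) 0, fun t => ?_⟩
    simp only [hi.extend_apply, hj.extend_apply]
    exact ⟨by ring, by linear_combination he t⟩
  · rintro ⟨η, ξ, h⟩
    have : NeZero l := ⟨by omega⟩
    have hshift : ∑ t, η (i (t + ⟨1, by omega⟩)) = ∑ t, η (i t) :=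
      Equiv.sum_comp (Equiv.addRight (⟨1, by omega⟩ : Fin l)) fun t => η (i t)
    have h₁ := Finset.sum_eq_zero fun t (_ : t ∈ Finset.univ) => (h t).1
    have h₂ := Finset.sum_eq_zero fun t (_ : t ∈ Finset.univ) => (h t).2
    simp only [Finset.sum_add_distrib] at h₁ h₂
    linear_combination h₁ - h₂ + hshift
end

section
/- For every game matrix k : Fin n_A → Fin n_B → ZMod d there exist functions η : Fin n_A → ZMod d and ξ : Fin n_B → ZMod d such that the matrix k'(x,y) = k(x,y) + η(x) + ξ(y) satisfies: (a) k'(x,y) = 0 whenever k(x,y) = 0 (the zero-graph H(k') contains H(k)), and (b) the bipartite simple graph H(k') is connected. In particular, if k' is obtained from k by such row and column shifts and maximizes the number of zero entries among all such shifted matrices, then H(k') is connected. -/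
/-- The shifted game matrix `k'(x,y) = k(x,y) + η(x) + ξ(y)`. -/
def shiftMat {nA nB d : ℕ} (k : Fin nA → Fin nB → ZMod d)
    (η : Fin nA → ZMod d) (ξ : Fin nB → ZMod d) : Fin nA → Fin nB → ZMod d :=
  fun x y => k x y + η x + ξ y

/-- The bipartite simple graph `H(k)` on `Fin nA ⊕ Fin nB`, with an edge between row
vertex `x` and column vertex `y` iff `k x y = 0`. -/
def Hgraph {nA nB d : ℕ} (k : Fin nA → Fin nB → ZMod d) :
    SimpleGraph (Fin nA ⊕ Fin nB) :=
  SimpleGraph.fromRel fun u v =>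
    ∃ x y, u = Sum.inl x ∧ v = Sum.inr y ∧ k x y = 0

/-- The number of zero entries of a game matrix. -/
def numZeros {nA nB d : ℕ} (k : Fin nA → Fin nB → ZMod d) : ℕ :=
  ((Finset.univ : Finset (Fin nA × Fin nB)).filter (fun p => k p.1 p.2 = 0)).card

theorem Hgraph_adj_of_eq_zero {nA nB d : ℕ} {k : Fin nA → Fin nB → ZMod d} {x : Fin nA}
    {y : Fin nB} (h : k x y = 0) : (Hgraph k).Adj (Sum.inl x) (Sum.inr y) := by
  rw [Hgraph, SimpleGraph.fromRel_adj]
  exact ⟨Sum.inl_ne_inr, Or.inl ⟨x, y, rfl, rfl, h⟩⟩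

theorem shiftMat_shiftMat {nA nB d : ℕ} (k : Fin nA → Fin nB → ZMod d)
    (η η' : Fin nA → ZMod d) (ξ ξ' : Fin nB → ZMod d) :
    shiftMat (shiftMat k η ξ) η' ξ' = shiftMat k (η + η') (ξ + ξ') := by
  funext x y
  simp only [shiftMat, Pi.add_apply]
  ring

theorem numZeros_lt_numZeros {nA nB d : ℕ} {k k' : Fin nA → Fin nB → ZMod d}
    (h : ∀ x y, k x y = 0 → k' x y = 0) {x : Fin nA} {y : Fin nB}
    (hne : k x y ≠ 0) (hzero : k' x y = 0) : numZeros k < numZeros k' := by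
  refine Finset.card_lt_card (Finset.ssubset_iff_of_subset ?_ |>.2 ⟨(x, y), ?_⟩)
  · exact Finset.monotone_filter_right _ fun p _ hp => h p.1 p.2 hp
  · simp [hne, hzero]

open Classical in
/-- If no zero of `k` joins `S` to its complement, then shifting the rows of `S` by `c` and the
columns of `S` by `-c` preserves zeros. A suitable `c` creates a new zero across the cut. -/
theorem exists_shift_of_cut {nA nB d : ℕ} (k : Fin nA → Fin nB → ZMod d)
    (S : Set (Fin nA ⊕ Fin nB))
    (hS : ∀ x y, k x y = 0 → (Sum.inl x ∈ S ↔ Sum.inr y ∈ S)) {x : Fin nA} {y : Fin nB}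
    (hxy : ¬(Sum.inl x ∈ S ↔ Sum.inr y ∈ S)) :
    ∃ (η : Fin nA → ZMod d) (ξ : Fin nB → ZMod d),
      (∀ x y, k x y = 0 → shiftMat k η ξ x y = 0) ∧
      numZeros k < numZeros (shiftMat k η ξ) := by
  let c : ZMod d := if Sum.inl x ∈ S then -k x y else k x y
  let η : Fin nA → ZMod d := fun a => if Sum.inl a ∈ S then c else 0
  let ξ : Fin nB → ZMod d := fun b => if Sum.inr b ∈ S then -c else 0
  have hpres : ∀ a b, k a b = 0 → shiftMat k η ξ a b = 0 := by
    intro a b hab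
    by_cases hb : Sum.inr b ∈ S <;> simp [shiftMat, η, ξ, hS a b hab, hab, hb]
  refine ⟨η, ξ, hpres, numZeros_lt_numZeros hpres (fun h => hxy (hS x y h)) ?_⟩
  by_cases hx : Sum.inl x ∈ S <;> by_cases hy : Sum.inr y ∈ S <;>
    simp_all [shiftMat, η, ξ, c]

theorem exists_cross_pair {α β : Type*} [Nonempty α] [Nonempty β] {S : Set (α ⊕ β)}
    {u v : α ⊕ β} (hu : u ∈ S) (hv : v ∉ S) :
    ∃ x y, ¬((Sum.inl x : α ⊕ β) ∈ S ↔ (Sum.inr y : α ⊕ β) ∈ S) := by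
  by_contra! h
  obtain ⟨a⟩ := ‹Nonempty α›
  obtain ⟨b⟩ := ‹Nonempty β›
  rcases u with u | u <;> rcases v with v | v
  · exact hv ((h v b).2 ((h u b).1 hu))
  · exact hv ((h u v).1 hu)
  · exact hv ((h v u).2 hu)
  · exact hv ((h a v).1 ((h a u).2 hu))

theorem exists_shift_numZeros_lt {nA nB d : ℕ} [NeZero nA] [NeZero nB]
    (k : Fin nA → Fin nB → ZMod d) (hk : ¬(Hgraph k).Connected) :
    ∃ (η : Fin nA → ZMod d) (ξ : Fin nB → ZMod d),
      (∀ x y, k x y = 0 → shiftMat k η ξ x y = 0) ∧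
      numZeros k < numZeros (shiftMat k η ξ) := by
  have : ∃ u v, ¬(Hgraph k).Reachable u v := by
    by_contra! h
    exact hk { preconnected := h, nonempty := ⟨Sum.inl 0⟩ }
  obtain ⟨u, v, huv⟩ := this
  obtain ⟨x, y, hxy⟩ := exists_cross_pair (S := {w | (Hgraph k).Reachable u w})
    (SimpleGraph.Reachable.refl u) huv
  refine exists_shift_of_cut k _ (fun a b hab => ?_) hxy
  have hadj := (Hgraph_adj_of_eq_zero hab).reachable
  exact ⟨fun h => h.trans hadj, fun h => h.trans hadj.symm⟩

/-- For every game matrix there are row/column shifts whose zero-graph contains the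
original one and is connected; in particular any shifted matrix maximizing the number of
zero entries has connected zero-graph. -/
theorem exists_shift_connected {nA nB d : ℕ} (hA : 2 ≤ nA) (hB : 2 ≤ nB) (hd : 1 ≤ d)
    (k : Fin nA → Fin nB → ZMod d) :
    (∃ (η : Fin nA → ZMod d) (ξ : Fin nB → ZMod d),
      (∀ x y, k x y = 0 → shiftMat k η ξ x y = 0) ∧
      (Hgraph (shiftMat k η ξ)).Connected) ∧
    (∀ (η : Fin nA → ZMod d) (ξ : Fin nB → ZMod d),
      (∀ (η' : Fin nA → ZMod d) (ξ' : Fin nB → ZMod d),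
        numZeros (shiftMat k η' ξ') ≤ numZeros (shiftMat k η ξ)) →
      (Hgraph (shiftMat k η ξ)).Connected) := by
  have : NeZero nA := ⟨by omega⟩
  have : NeZero nB := ⟨by omega⟩
  have : NeZero d := ⟨by omega⟩
  constructor
  · let T : Set ((Fin nA → ZMod d) × (Fin nB → ZMod d)) :=
      {p | ∀ x y, k x y = 0 → shiftMat k p.1 p.2 x y = 0}
    have hT : T.Nonempty := ⟨(0, 0), fun x y h => by simp [shiftMat, h]⟩
    obtain ⟨⟨η, ξ⟩, hp, hmax⟩ :=
      Set.exists_max_image T (fun p => numZeros (shiftMat k p.1 p.2)) T.toFinite hT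
    refine ⟨η, ξ, hp, ?_⟩
    by_contra hcon
    obtain ⟨η', ξ', hpres, hlt⟩ := exists_shift_numZeros_lt _ hcon
    rw [shiftMat_shiftMat] at hpres hlt
    exact hlt.not_ge (hmax (η + η', ξ + ξ') fun x y h => hpres x y (hp x y h))
  · intro η ξ hmax
    by_contra hcon
    obtain ⟨η', ξ', -, hlt⟩ := exists_shift_numZeros_lt _ hcon
    rw [shiftMat_shiftMat] at hlt
    exact hlt.not_ge (hmax _ _)
end

section
/- Let k : Fin n_A → Fin n_B → ZMod d be a game matrix (n_A, n_B ≥ 2). Then β_C(k) = (n_A − 1)(n_B − 1) if and only if for every pair of functions η : Fin n_A → ZMod d, ξ : Fin n_B → ZMod d which maximizes the number of zero entries of the shifted matrix k'(x,y) = k(x,y) + η(x) + ξ(y), the bipartite simple graph H(k') is a tree (i.e. connected and acyclic). -/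
theorem Hgraph_adj_inl_inr {nA nB d : ℕ} (k : Fin nA → Fin nB → ZMod d)
    (x : Fin nA) (y : Fin nB) : (Hgraph k).Adj (Sum.inl x) (Sum.inr y) ↔ k x y = 0 := by
  simp [Hgraph]

theorem card_edgeSet_Hgraph {nA nB d : ℕ} (k : Fin nA → Fin nB → ZMod d) :
    Nat.card (Hgraph k).edgeSet = numZeros k := by
  classical
  rw [numZeros, Nat.card_eq_fintype_card, ← SimpleGraph.edgeFinset_card]
  symm
  refine Finset.card_bij (fun p _ => s(Sum.inl p.1, Sum.inr p.2)) ?_ ?_ ?_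
  · rintro ⟨x, y⟩ hp
    simpa [Hgraph_adj_inl_inr] using hp
  · rintro ⟨x, y⟩ _ ⟨x', y'⟩ _ h
    simpa using h
  · intro e
    induction e with
    | h u v =>
      intro he
      rw [SimpleGraph.mem_edgeFinset, SimpleGraph.mem_edgeSet, Hgraph,
        SimpleGraph.fromRel_adj] at he
      obtain ⟨-, ⟨x, y, rfl, rfl, h⟩ | ⟨x, y, rfl, rfl, h⟩⟩ := he
      · exact ⟨(x, y), by simpa using h, rfl⟩
      · exact ⟨(x, y), by simpa using h, Sym2.eq_swap⟩

theorem numContr_add_numZeros {nA nB d : ℕ} (k : Fin nA → Fin nB → ZMod d)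
    (a : Fin nA → ZMod d) (b : Fin nB → ZMod d) :
    numContr k a b + numZeros (shiftMat k a (-b)) = nA * nB := by
  have h : ∀ p : Fin nA × Fin nB,
      b p.2 = a p.1 + k p.1 p.2 ↔ shiftMat k a (-b) p.1 p.2 = 0 := fun p => by
    rw [shiftMat, Pi.neg_apply, ← sub_eq_add_neg, sub_eq_zero, add_comm, eq_comm]
  simp only [numContr, numZeros, ne_eq, h]
  rw [add_comm, Finset.card_filter_add_card_filter_not]
  simp

theorem exists_numZeros_shiftMat_max {nA nB d : ℕ} (k : Fin nA → Fin nB → ZMod d) :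
    ∃ (η : Fin nA → ZMod d) (ξ : Fin nB → ZMod d),
      (∀ (η' : Fin nA → ZMod d) (ξ' : Fin nB → ZMod d),
        numZeros (shiftMat k η' ξ') ≤ numZeros (shiftMat k η ξ)) ∧
      betaC k + numZeros (shiftMat k η ξ) = nA * nB := by
  obtain ⟨a, b, hab⟩ : betaC k ∈ { m | ∃ (a : Fin nA → ZMod d) (b : Fin nB → ZMod d),
      numContr k a b = m } := Nat.sInf_mem ⟨_, 0, 0, rfl⟩
  refine ⟨a, -b, fun η' ξ' => ?_, hab ▸ numContr_add_numZeros k a b⟩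
  have hle : betaC k ≤ numContr k η' (-ξ') := Nat.sInf_le ⟨η', -ξ', rfl⟩
  have h₁ := numContr_add_numZeros k a b
  have h₂ := numContr_add_numZeros k η' (-ξ')
  rw [neg_neg] at h₂
  omega

/-- Shifting the connected component of a row vertex preserves all zeros, so at a maximizer
no new zero can be created this way. -/
theorem Hgraph_reachable_of_max {nA nB d : ℕ} (k : Fin nA → Fin nB → ZMod d)
    (η : Fin nA → ZMod d) (ξ : Fin nB → ZMod d)
    (hmax : ∀ (η' : Fin nA → ZMod d) (ξ' : Fin nB → ZMod d),
      numZeros (shiftMat k η' ξ') ≤ numZeros (shiftMat k η ξ))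
    (x₀ : Fin nA) (y₀ : Fin nB) :
    (Hgraph (shiftMat k η ξ)).Reachable (Sum.inl x₀) (Sum.inr y₀) := by
  classical
  by_contra hr
  set G := Hgraph (shiftMat k η ξ) with hG
  let c : ZMod d := -shiftMat k η ξ x₀ y₀
  let η' : Fin nA → ZMod d := fun x =>
    η x + if G.Reachable (Sum.inl x₀) (Sum.inl x) then c else 0
  let ξ' : Fin nB → ZMod d := fun y =>
    ξ y - if G.Reachable (Sum.inl x₀) (Sum.inr y) then c else 0
  refine (hmax η' ξ').not_gt (Finset.card_lt_card (Finset.ssubset_iff_of_subset ?_ |>.2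
    ⟨(x₀, y₀), ?_, ?_⟩))
  · rintro ⟨x, y⟩ hp
    have h0 : shiftMat k η ξ x y = 0 := by simpa using hp
    have hadj : G.Adj (Sum.inl x) (Sum.inr y) := (Hgraph_adj_inl_inr _ x y).2 h0
    have hiff : G.Reachable (Sum.inl x₀) (Sum.inl x) ↔ G.Reachable (Sum.inl x₀) (Sum.inr y) :=
      ⟨fun h => h.trans hadj.reachable, fun h => h.trans hadj.symm.reachable⟩
    simp only [Finset.mem_filter, Finset.mem_univ, true_and]
    rw [← h0]
    simp only [shiftMat, η', ξ', hiff]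
    ring
  · refine Finset.mem_filter.2 ⟨Finset.mem_univ _, ?_⟩
    simp only [shiftMat, η', ξ', c, if_neg hr, if_pos (SimpleGraph.Reachable.refl _)]
    ring
  · intro hp
    have h0 : shiftMat k η ξ x₀ y₀ = 0 := by simpa using hp
    exact hr ((Hgraph_adj_inl_inr _ x₀ y₀).2 h0).reachable

theorem Hgraph_connected_of_max {nA nB d : ℕ} (hA : 0 < nA) (hB : 0 < nB)
    (k : Fin nA → Fin nB → ZMod d) (η : Fin nA → ZMod d) (ξ : Fin nB → ZMod d)
    (hmax : ∀ (η' : Fin nA → ZMod d) (ξ' : Fin nB → ZMod d),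
      numZeros (shiftMat k η' ξ') ≤ numZeros (shiftMat k η ξ)) :
    (Hgraph (shiftMat k η ξ)).Connected := by
  have key := Hgraph_reachable_of_max k η ξ hmax
  refine SimpleGraph.connected_iff_exists_forall_reachable _ |>.2 ⟨Sum.inl ⟨0, hA⟩, ?_⟩
  rintro (x | y)
  · exact (key _ ⟨0, hB⟩).trans (key x ⟨0, hB⟩).symm
  · exact key _ y

theorem Hgraph_isTree_iff {nA nB d : ℕ} (k : Fin nA → Fin nB → ZMod d) :
    (Hgraph k).IsTree ↔ (Hgraph k).Connected ∧ numZeros k + 1 = nA + nB := by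
  rw [SimpleGraph.isTree_iff_connected_and_card, card_edgeSet_Hgraph]
  simp

/-- A game matrix has the maximal contradiction number `(n_A − 1)(n_B − 1)` iff for every
pair of shifts maximizing the number of zero entries, the zero-graph of the shifted matrix
is a tree. -/
theorem betaC_max_iff_tree {nA nB d : ℕ} (hA : 2 ≤ nA) (hB : 2 ≤ nB) (hd : 1 ≤ d)
    (k : Fin nA → Fin nB → ZMod d) :
    betaC k = (nA - 1) * (nB - 1) ↔
    ∀ (η : Fin nA → ZMod d) (ξ : Fin nB → ZMod d),
      (∀ (η' : Fin nA → ZMod d) (ξ' : Fin nB → ZMod d),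
        numZeros (shiftMat k η' ξ') ≤ numZeros (shiftMat k η ξ)) →
      (Hgraph (shiftMat k η ξ)).IsTree := by
  obtain ⟨η₀, ξ₀, hmax₀, hβ⟩ := exists_numZeros_shiftMat_max k
  have hmul : (nA - 1) * (nB - 1) + (nA + nB - 1) = nA * nB := by
    obtain ⟨m, rfl⟩ := Nat.exists_eq_add_of_le' hA
    obtain ⟨n, rfl⟩ := Nat.exists_eq_add_of_le' hB
    rw [show m + 2 - 1 = m + 1 by omega, show n + 2 - 1 = n + 1 by omega,
      show m + 2 + (n + 2) - 1 = m + n + 3 by omega]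
    ring
  constructor
  · intro h η ξ hmax
    have := hmax η₀ ξ₀
    have := hmax₀ η ξ
    exact (Hgraph_isTree_iff _).2
      ⟨Hgraph_connected_of_max (by omega) (by omega) k η ξ hmax, by omega⟩
  · intro h
    have := ((Hgraph_isTree_iff _).1 (h η₀ ξ₀ hmax₀)).2
    omega
end

section
/- Let k : Fin n_A → Fin n_B → ZMod d (n_A, n_B ≥ 2) be a game matrix whose first row and first column are zero, i.e. k(0,j) = 0 and k(i,0) = 0 for all i, j. If β_C(k) = (n_A − 1)(n_B − 1), then the entries k(i,j) with i ≥ 1 and j ≥ 1 are pairwise distinct and all nonzero: k(i,j) ≠ 0 for all i,j ≥ 1, and k(i,j) ≠ k(i',j') whenever (i,j) ≠ (i',j') with i,i',j,j' ≥ 1. -/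
/-- If some strategy satisfies `nA + nB` distinct cells, then `β_C` is not maximal. -/
theorem betaC_ne_of_injective {nA nB d : ℕ} (hA : 2 ≤ nA) (hB : 2 ≤ nB)
    (k : Fin nA → Fin nB → ZMod d) (a : Fin nA → ZMod d) (b : Fin nB → ZMod d)
    (f : Fin nA ⊕ Fin nB → Fin nA × Fin nB) (hf : Function.Injective f)
    (hsat : ∀ s, b (f s).2 = a (f s).1 + k (f s).1 (f s).2) :
    betaC k ≠ (nA - 1) * (nB - 1) := by
  intro h
  have hle : betaC k ≤ numContr k a b := Nat.sInf_le ⟨a, b, rfl⟩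
  have hsplit := Finset.card_filter_add_card_filter_not
    (s := (Finset.univ : Finset (Fin nA × Fin nB))) (fun p => b p.2 = a p.1 + k p.1 p.2)
  have hcard : (Finset.univ : Finset (Fin nA ⊕ Fin nB)).card ≤
      (Finset.univ.filter (fun p : Fin nA × Fin nB => b p.2 = a p.1 + k p.1 p.2)).card :=
    Finset.card_le_card_of_injOn f (fun s _ => by simpa using hsat s) hf.injOn
  simp only [Finset.card_univ, Fintype.card_sum, Fintype.card_prod, Fintype.card_fin]
    at hcard hsplit
  unfold numContr at hle
  obtain ⟨m, rfl⟩ : ∃ m, nA = m + 1 := ⟨nA - 1, by omega⟩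
  obtain ⟨n, rfl⟩ : ∃ n, nB = n + 1 := ⟨nB - 1, by omega⟩
  simp only [Nat.add_sub_cancel] at h
  simp only [ne_eq] at hle
  have : (m + 1) * (n + 1) = m * n + m + n + 1 := by ring
  omega

/-- In a game matrix whose row `r` and column `c` vanish, a further zero entry rules out
maximality of `β_C`. -/
theorem betaC_ne_of_entry_eq_zero {nA nB d : ℕ} (hA : 2 ≤ nA) (hB : 2 ≤ nB)
    (k : Fin nA → Fin nB → ZMod d) {r i : Fin nA} {c j : Fin nB}
    (hrow : ∀ y, k r y = 0) (hcol : ∀ x, k x c = 0) (hi : i ≠ r) (hj : j ≠ c)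
    (h0 : k i j = 0) : betaC k ≠ (nA - 1) * (nB - 1) := by
  refine betaC_ne_of_injective hA hB k (fun _ => 0) (fun _ => 0)
    (Sum.elim (fun x => (x, c)) (fun y => if y = c then (i, j) else (r, y))) ?_ ?_
  · rintro (x | x) (y | y) hxy <;> simp only [Sum.elim_inl, Sum.elim_inr] at hxy <;> grind
  · rintro (x | x) <;> simp only [Sum.elim_inl, Sum.elim_inr] <;> grind

/-- In a game matrix whose row `r` and column `c` vanish, two equal entries outside that row and
column rule out maximality of `β_C`. -/
theorem betaC_ne_of_entries_eq {nA nB d : ℕ} (hA : 2 ≤ nA) (hB : 2 ≤ nB)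
    (k : Fin nA → Fin nB → ZMod d) {r i i' : Fin nA} {c j j' : Fin nB}
    (hrow : ∀ y, k r y = 0) (hcol : ∀ x, k x c = 0) (hi : i ≠ r) (hi' : i' ≠ r)
    (hj : j ≠ c) (hj' : j' ≠ c) (hne : (i, j) ≠ (i', j')) (heq : k i j = k i' j') :
    betaC k ≠ (nA - 1) * (nB - 1) := by
  refine betaC_ne_of_injective hA hB k (fun x => if x = r then k i j else 0)
    (fun y => if y = j' then k i j else k i y)
    (Sum.elim (fun x => if x = r then (r, j) else (x, c))
      (fun y => if y = c then (if j = j' then (i, j) else (r, j'))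
        else if y = j' then (i', j') else (i, y))) ?_ ?_
  · rintro (x | x) (y | y) hxy <;> simp only [Sum.elim_inl, Sum.elim_inr] at hxy <;> grind
  · rintro (x | x) <;> simp only [Sum.elim_inl, Sum.elim_inr] <;> grind

/-- If a game matrix with zero first row and first column has the maximal contradiction
number `(n_A − 1)(n_B − 1)`, then its remaining entries are all nonzero and pairwise
distinct. -/
theorem entries_distinct_of_betaC_max {nA nB d : ℕ} (hA : 2 ≤ nA) (hB : 2 ≤ nB)
    (hd : 1 ≤ d) (k : Fin nA → Fin nB → ZMod d)
    (hrow : ∀ j : Fin nB, k ⟨0, by omega⟩ j = 0)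
    (hcol : ∀ i : Fin nA, k i ⟨0, by omega⟩ = 0)
    (h : betaC k = (nA - 1) * (nB - 1)) :
    (∀ (i : Fin nA) (j : Fin nB), 1 ≤ (i : ℕ) → 1 ≤ (j : ℕ) → k i j ≠ 0) ∧
    (∀ (i i' : Fin nA) (j j' : Fin nB),
      1 ≤ (i : ℕ) → 1 ≤ (i' : ℕ) → 1 ≤ (j : ℕ) → 1 ≤ (j' : ℕ) →
      (i, j) ≠ (i', j') → k i j ≠ k i' j') := by
  have ne_zero : ∀ {n : ℕ} (hn : 0 < n) (x : Fin n), 1 ≤ (x : ℕ) → x ≠ ⟨0, hn⟩ := by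
    rintro n hn x hx rfl
    simp at hx
  refine ⟨fun i j hi hj h0 => ?_, fun i i' j j' hi hi' hj hj' hne heq => ?_⟩
  · exact betaC_ne_of_entry_eq_zero hA hB k hrow hcol (ne_zero _ i hi) (ne_zero _ j hj) h0 h
  · exact betaC_ne_of_entries_eq hA hB k hrow hcol (ne_zero _ i hi) (ne_zero _ i' hi')
      (ne_zero _ j hj) (ne_zero _ j' hj') hne heq h
end

section
/- If a game matrix k : Fin n_A → Fin n_B → ZMod d (n_A, n_B ≥ 2) has the maximal contradiction number β_C(k) = (n_A − 1)(n_B − 1), then the number of outputs satisfies d ≥ (n_A − 1)(n_B − 1) + 1. -/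
/-- The game matrix normalized so that its first row and first column vanish. -/
def normalizedEntry {m n d : ℕ} (k : Fin (m + 1) → Fin (n + 1) → ZMod d)
    (p : Fin (m + 1) × Fin (n + 1)) : ZMod d :=
  k p.1 p.2 - k p.1 0 - k 0 p.2 + k 0 0

/-- The corner position together with all positions outside the first row and column. -/
def essentialPositions (m n : ℕ) : Finset (Fin (m + 1) × Fin (n + 1)) :=
  insert (0, 0) ((Finset.univ.erase 0) ×ˢ (Finset.univ.erase 0))

theorem mem_essentialPositions {m n : ℕ} {p : Fin (m + 1) × Fin (n + 1)} :
    p ∈ essentialPositions m n ↔ (p.1 = 0 ∧ p.2 = 0) ∨ (p.1 ≠ 0 ∧ p.2 ≠ 0) := by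
  simp [essentialPositions, Prod.ext_iff]

theorem card_essentialPositions (m n : ℕ) : (essentialPositions m n).card = m * n + 1 := by
  rw [essentialPositions, Finset.card_insert_of_notMem (by simp)]
  simp [Finset.card_product]

/-- For every `t` some strategy has contradictions only at essential positions whose
normalized entry differs from `t`. -/
theorem exists_strategy_of_value {m n d : ℕ} (k : Fin (m + 1) → Fin (n + 1) → ZMod d)
    (t : ZMod d) :
    ∃ (a : Fin (m + 1) → ZMod d) (b : Fin (n + 1) → ZMod d), ∀ p : Fin (m + 1) × Fin (n + 1),
      b p.2 ≠ a p.1 + k p.1 p.2 → p ∈ essentialPositions m n ∧ normalizedEntry k p ≠ t := by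
  refine ⟨fun x => (if x = 0 then 0 else -t) - k x 0,
    fun y => (if y = 0 then -t else 0) + k 0 y - k 0 0, ?_⟩
  rintro ⟨x, y⟩ hxy
  contrapose! hxy
  rw [mem_essentialPositions] at hxy
  by_cases hx : x = 0 <;> by_cases hy : y = 0 <;>
    simp [hx, hy, normalizedEntry] at hxy ⊢
  · exact hxy.symm
  · ring
  · rw [← hxy]
    ring

/-- If two essential positions share a normalized entry, the contradiction number is not
maximal. -/
theorem betaC_lt_of_normalizedEntry_eq {m n d : ℕ} (k : Fin (m + 1) → Fin (n + 1) → ZMod d)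
    {p q : Fin (m + 1) × Fin (n + 1)} (hp : p ∈ essentialPositions m n)
    (hq : q ∈ essentialPositions m n) (hpq : p ≠ q)
    (h : normalizedEntry k p = normalizedEntry k q) : betaC k < m * n := by
  obtain ⟨a, b, hab⟩ := exists_strategy_of_value k (normalizedEntry k p)
  have hsub : Finset.univ.filter
      (fun r : Fin (m + 1) × Fin (n + 1) => b r.2 ≠ a r.1 + k r.1 r.2) ⊆
      ((essentialPositions m n).erase p).erase q := by
    intro r hr
    obtain ⟨hr, hne⟩ := hab r (Finset.mem_filter.mp hr).2
    refine Finset.mem_erase.mpr ⟨?_, Finset.mem_erase.mpr ⟨?_, hr⟩⟩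
    · rintro rfl
      exact hne h.symm
    · rintro rfl
      exact hne rfl
  have hle : betaC k ≤ (((essentialPositions m n).erase p).erase q).card :=
    (betaC_le_numContr k a b).trans (Finset.card_le_card hsub)
  have hq' : q ∈ (essentialPositions m n).erase p := Finset.mem_erase.mpr ⟨hpq.symm, hq⟩
  have h1 := Finset.card_erase_add_one hq'
  have h2 := Finset.card_erase_add_one hp
  rw [card_essentialPositions] at h2
  omega

/-- If a game matrix attains the maximal contradiction number `(n_A − 1)(n_B − 1)`, then
the number of outputs satisfies `d ≥ (n_A − 1)(n_B − 1) + 1`. -/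
theorem outputs_lower_bound {nA nB d : ℕ} (hA : 2 ≤ nA) (hB : 2 ≤ nB) (hd : 1 ≤ d)
    (k : Fin nA → Fin nB → ZMod d)
    (h : betaC k = (nA - 1) * (nB - 1)) :
    (nA - 1) * (nB - 1) + 1 ≤ d := by
  obtain ⟨m, rfl⟩ : ∃ m, nA = m + 1 := ⟨nA - 1, by omega⟩
  obtain ⟨n, rfl⟩ : ∃ n, nB = n + 1 := ⟨nB - 1, by omega⟩
  have : NeZero d := ⟨by omega⟩
  simp only [Nat.add_sub_cancel] at h ⊢
  have hinj : Set.InjOn (normalizedEntry k) (essentialPositions m n) := by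
    intro p hp q hq hpq
    by_contra hne
    exact (betaC_lt_of_normalizedEntry_eq k hp hq hne hpq).ne h
  rw [← card_essentialPositions, ← Finset.card_image_of_injOn hinj]
  exact (Finset.card_le_univ _).trans_eq (ZMod.card d)
end

section
/- Let s ≥ 2 and let p be a prime with p > s. For k ∈ {0,1,…,p−1} define the natural number x_k = Σ_{i=0}^{s−1} λ(k^{s−i})·(s·p)^i, where λ(m) denotes the residue of m modulo p with 0 ≤ λ(m) ≤ p−1. Then: (a) 0 = x_0 < x_1 < ⋯ < x_{p−1} and x_{p−1} < s^{s−1}·p^s; (b) the set {x_0,…,x_{p−1}} has the s-sum property: for every t with 1 ≤ t ≤ s and all functions f, g : Fin t → Fin p, if Σ_{j} x_{f(j)} = Σ_{j} x_{g(j)} then the multiset of values of f equals the multiset of values of g. -/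
theorem sum_digits_mul_pow_lt {B n : ℕ} {a : ℕ → ℕ} (ha : ∀ i < n, a i < B) :
    ∑ i ∈ Finset.range n, a i * B ^ i < B ^ n := by
  induction n with
  | zero => simp
  | succ n ih =>
    have hlow := ih fun i hi => ha i (by omega)
    have htop : (a n + 1) * B ^ n ≤ B * B ^ n := Nat.mul_le_mul_right _ (ha n (by omega))
    rw [Finset.sum_range_succ, pow_succ']
    linarith

theorem digits_eq_of_sum_mul_pow_eq {B n : ℕ} {a b : ℕ → ℕ}
    (ha : ∀ i < n, a i < B) (hb : ∀ i < n, b i < B)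
    (h : ∑ i ∈ Finset.range n, a i * B ^ i = ∑ i ∈ Finset.range n, b i * B ^ i) :
    ∀ i < n, a i = b i := by
  induction n with
  | zero => simp
  | succ n ih =>
    have ha' : ∀ i < n, a i < B := fun i hi => ha i (by omega)
    have hb' : ∀ i < n, b i < B := fun i hi => hb i (by omega)
    have hla := sum_digits_mul_pow_lt ha'
    have hlb := sum_digits_mul_pow_lt hb'
    rw [Finset.sum_range_succ, Finset.sum_range_succ] at h
    have htop : a n = b n := by
      have hdiv := congrArg (· / B ^ n) h
      have hpos : 0 < B ^ n := by omega
      simpa [Nat.add_mul_div_right _ _ hpos, Nat.div_eq_of_lt hla, Nat.div_eq_of_lt hlb]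
        using hdiv
    intro i hi
    rcases Nat.lt_succ_iff_lt_or_eq.mp hi with hi | rfl
    · exact ih ha' hb' (by rw [htop] at h; omega) i hi
    · exact htop

open MvPolynomial in
/-- Over a field in which `1, …, n` are nonzero, the power sums of degrees `1, …, n` determine
the elementary symmetric functions of degrees `0, …, n`. -/
theorem aeval_esymm_eq_of_sum_pow_eq {σ K : Type*} [Fintype σ] [Field K] {n : ℕ}
    (hn : ∀ k : ℕ, 1 ≤ k → k ≤ n → (k : K) ≠ 0) {u v : σ → K}
    (h : ∀ r : ℕ, 1 ≤ r → r ≤ n → ∑ j, u j ^ r = ∑ j, v j ^ r) (k : ℕ) (hk : k ≤ n) :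
    aeval u (esymm σ K k) = aeval v (esymm σ K k) := by
  induction k using Nat.strong_induction_on with
  | _ k ih =>
    rcases Nat.eq_zero_or_pos k with rfl | hpos
    · simp
    · apply mul_left_cancel₀ (hn k hpos hk)
      have newton : ∀ w : σ → K, (k : K) * aeval w (esymm σ K k) =
          (-1) ^ (k + 1) * ∑ a ∈ Finset.HasAntidiagonal.antidiagonal k with a.1 < k,
            (-1) ^ a.1 * aeval w (esymm σ K a.1) * ∑ j, w j ^ a.2 := by
        intro w
        simpa [psum] using congrArg (aeval w) (mul_esymm_eq_sum σ K k)
      rw [newton, newton]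
      congr 1
      refine Finset.sum_congr rfl fun a ha => ?_
      obtain ⟨hmem, hlt⟩ := Finset.mem_filter.mp ha
      rw [Finset.HasAntidiagonal.mem_antidiagonal] at hmem
      rw [ih a.1 hlt (by omega), h a.2 (by omega) (by omega)]

/-- Families of `Fintype.card σ` elements of a field with equal power sums of degrees
`1, …, Fintype.card σ` agree up to order, if these degrees are nonzero in the field. -/
theorem multiset_map_eq_of_sum_pow_eq {σ K : Type*} [Fintype σ] [Field K]
    (hn : ∀ k : ℕ, 1 ≤ k → k ≤ Fintype.card σ → (k : K) ≠ 0) {u v : σ → K}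
    (h : ∀ r : ℕ, 1 ≤ r → r ≤ Fintype.card σ → ∑ j, u j ^ r = ∑ j, v j ^ r) :
    Multiset.map u Finset.univ.val = Multiset.map v Finset.univ.val := by
  rw [← Polynomial.roots_multiset_prod_X_sub_C (Multiset.map u Finset.univ.val),
    ← Polynomial.roots_multiset_prod_X_sub_C (Multiset.map v Finset.univ.val),
    Multiset.prod_X_sub_X_eq_sum_esymm, Multiset.prod_X_sub_X_eq_sum_esymm]
  congr 1
  simp only [Multiset.card_map, Finset.card_val, Finset.card_univ]
  refine Finset.sum_congr rfl fun k hk => ?_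
  have hk' : k ≤ Fintype.card σ := Nat.lt_succ_iff.mp (Finset.mem_range.mp hk)
  rw [← MvPolynomial.aeval_esymm_eq_multiset_esymm σ K,
    ← MvPolynomial.aeval_esymm_eq_multiset_esymm σ K,
    aeval_esymm_eq_of_sum_pow_eq hn h k hk']

/-- Rudin's construction: for `s ≥ 2` and a prime `p > s`, the numbers
`x_k = Σ_{i=0}^{s−1} (k^{s−i} mod p)·(s·p)^i` (for `k = 0,…,p−1`) are strictly
increasing, bounded by `s^{s−1}·p^s`, and have the `s`-sum property: sums of any `t ≤ s`
of them (with repetitions) determine the summands up to order. -/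
theorem rudin_s_sum_property {s p : ℕ} (hs : 2 ≤ s) (hp : p.Prime) (hsp : s < p)
    (x : ℕ → ℕ)
    (hx : ∀ m : ℕ, x m = ∑ i ∈ Finset.range s, (m ^ (s - i) % p) * (s * p) ^ i) :
    x 0 = 0 ∧
    (∀ a b : ℕ, a < b → b < p → x a < x b) ∧
    x (p - 1) < s ^ (s - 1) * p ^ s ∧
    (∀ t : ℕ, 1 ≤ t → t ≤ s → ∀ f g : Fin t → Fin p,
      (∑ j : Fin t, x (f j)) = (∑ j : Fin t, x (g j)) →
      Multiset.map f (Finset.univ : Finset (Fin t)).val =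
        Multiset.map g (Finset.univ : Finset (Fin t)).val) := by
  have : Fact p.Prime := ⟨hp⟩
  have hmod : ∀ m, m % p < p := fun m => Nat.mod_lt _ hp.pos
  have hple : p ≤ s * p := Nat.le_mul_of_pos_left p (by omega)
  have hbounds : ∀ m < p, m * (s * p) ^ (s - 1) ≤ x m ∧ x m < (m + 1) * (s * p) ^ (s - 1) := by
    intro m hm
    have hlow := sum_digits_mul_pow_lt (B := s * p) (n := s - 1) (a := fun i => m ^ (s - i) % p)
      fun i _ => (hmod _).trans_le hple
    have hxm := hx m
    rw [← Nat.sub_add_cancel (by omega : 1 ≤ s), Finset.sum_range_succ,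
      Nat.sub_add_cancel (by omega : 1 ≤ s), show s - (s - 1) = 1 by omega, pow_one,
      Nat.mod_eq_of_lt hm] at hxm
    exact ⟨hxm ▸ Nat.le_add_left _ _, by linarith⟩
  refine ⟨?_, ?_, ?_, ?_⟩
  · rw [hx]
    refine Finset.sum_eq_zero fun i hi => ?_
    rw [zero_pow (by have := Finset.mem_range.mp hi; omega), Nat.zero_mod, zero_mul]
  · intro a b hab hb
    calc x a < (a + 1) * (s * p) ^ (s - 1) := (hbounds a (hab.trans hb)).2
      _ ≤ b * (s * p) ^ (s - 1) := Nat.mul_le_mul_right _ hab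
      _ ≤ x b := (hbounds b hb).1
  · calc x (p - 1) < (p - 1 + 1) * (s * p) ^ (s - 1) := (hbounds (p - 1) (by omega)).2
      _ = s ^ (s - 1) * (p ^ (s - 1) * p) := by
        rw [Nat.sub_add_cancel hp.one_le, mul_pow]; ring
      _ = s ^ (s - 1) * p ^ s := by rw [← pow_succ, Nat.sub_add_cancel (by omega)]
  · intro t ht hts f g hfg
    have hdigit : ∀ (w : Fin t → Fin p) (i : ℕ), ∑ j, (w j : ℕ) ^ (s - i) % p < s * p := by
      intro w i
      have : Nonempty (Fin t) := ⟨⟨0, ht⟩⟩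
      calc ∑ j, (w j : ℕ) ^ (s - i) % p < ∑ _j : Fin t, p :=
            Finset.sum_lt_sum_of_nonempty Finset.univ_nonempty fun j _ => hmod _
        _ = t * p := by simp
        _ ≤ s * p := Nat.mul_le_mul_right _ hts
    have hexpand : ∀ w : Fin t → Fin p, ∑ j, x (w j) =
        ∑ i ∈ Finset.range s, (∑ j, (w j : ℕ) ^ (s - i) % p) * (s * p) ^ i := by
      intro w
      simp_rw [hx, Finset.sum_mul]
      exact Finset.sum_comm
    rw [hexpand, hexpand] at hfg
    have hdigits := digits_eq_of_sum_mul_pow_eq (fun i _ => hdigit f i) (fun i _ => hdigit g i) hfg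
    have hpow : ∀ r : ℕ, 1 ≤ r → r ≤ Fintype.card (Fin t) →
        ∑ j, ((f j : ℕ) : ZMod p) ^ r = ∑ j, ((g j : ℕ) : ZMod p) ^ r := by
      intro r hr hrt
      rw [Fintype.card_fin] at hrt
      have h := congrArg (Nat.cast : ℕ → ZMod p) (hdigits (s - r) (by omega))
      simpa [Nat.sub_sub_self (hrt.trans hts)] using h
    have hcast : ∀ k : ℕ, 1 ≤ k → k ≤ Fintype.card (Fin t) → (k : ZMod p) ≠ 0 := by
      intro k hk hkt hzero
      rw [Fintype.card_fin] at hkt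
      have := Nat.le_of_dvd hk ((ZMod.natCast_eq_zero_iff k p).mp hzero)
      omega
    have hinj : Function.Injective fun a : Fin p => ((a : ℕ) : ZMod p) := by
      intro a b hab
      have h := (ZMod.natCast_eq_natCast_iff' _ _ _).mp hab
      rw [Nat.mod_eq_of_lt a.2, Nat.mod_eq_of_lt b.2] at h
      exact Fin.ext h
    apply Multiset.map_injective hinj
    simpa only [Multiset.map_map, Function.comp_def] using
      multiset_map_eq_of_sum_pow_eq hcast hpow
end

section
/- For every n ≥ 2 and every s with 2 ≤ s ≤ n, there exist a number of outputs d with 1 ≤ d ≤ (2·s·n²)^s and a game matrix k : Fin n → Fin n → ZMod d such that n² − β_C(k) ≤ 2·n^{1+1/s} (as real numbers); equivalently, the classical value satisfies p_Cl(k) = 1 − β_C(k)/n² ≤ 2·n^{−1+1/s}. -/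
open Finset in
/-- Union bound: if there are fewer pairs of a predictor and an `M`-subset of positions than values
on `M` positions, some function agrees with every predictor on fewer than `M` positions. -/
theorem exists_forall_card_agree_lt {ι S R : Type*} [Fintype ι] [DecidableEq ι] [Fintype S]
    [Fintype R] [DecidableEq R] [Nonempty R] (F : S → ι → R) (M : ℕ)
    (h : (Fintype.card ι).choose M * Fintype.card S < Fintype.card R ^ M) :
    ∃ f : ι → R, ∀ t, #{p | f p = F t p} < M := by
  by_contra! hf
  have cover : (univ : Finset (ι → R)) ⊆
      (powersetCard M (univ : Finset ι) ×ˢ (univ : Finset S)).biUnion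
        fun q => Fintype.piFinset fun p => if p ∈ q.1 then {F q.2 p} else univ := by
    intro f _
    obtain ⟨t, ht⟩ := hf f
    obtain ⟨W, hW, hWM⟩ := exists_subset_card_eq ht
    refine mem_biUnion.2 ⟨(W, t), by simp [mem_powersetCard, hWM], ?_⟩
    rw [Fintype.mem_piFinset]
    intro p
    by_cases hp : p ∈ W
    · simpa [hp] using hW hp
    · simp [hp]
  have hcard := (card_le_card cover).trans (card_biUnion_le_card_mul _ _
    (Fintype.card R ^ (Fintype.card ι - M)) ?_)
  · rw [card_univ, Fintype.card_fun, card_product, card_powersetCard, card_univ, card_univ]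
      at hcard
    have hR : 0 < Fintype.card R := Fintype.card_pos
    rcases le_or_gt M (Fintype.card ι) with hM | hM
    · have := Nat.mul_lt_mul_of_pos_right h (pow_pos hR (Fintype.card ι - M))
      rw [← pow_add, Nat.add_sub_cancel' hM] at this
      omega
    · rw [Nat.choose_eq_zero_of_lt hM, zero_mul, zero_mul] at hcard
      exact (pow_pos hR _).not_ge hcard
  · rintro ⟨W, t⟩ hW
    have hWM : #W = M := by simpa [mem_powersetCard] using hW
    rw [Fintype.card_piFinset]
    have hc (p : ι) : #(if p ∈ W then {F t p} else univ : Finset R) =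
        if p ∈ W then 1 else Fintype.card R := by split_ifs <;> simp
    simp only [hc]
    rw [prod_ite, prod_const_one, one_mul, prod_const, ← hWM, ← card_compl]
    exact (congrArg _ (congrArg _ (by ext; simp))).le

/-- If fewer than `M` pairs of inputs are won by each classical strategy, then
`n² - β_C(k) < M`. -/
theorem sq_lt_add_betaC {n d M : ℕ} (k : Fin n → Fin n → ZMod d)
    (h : ∀ a b : Fin n → ZMod d,
      ((Finset.univ : Finset (Fin n × Fin n)).filter
        (fun p => k p.1 p.2 = b p.2 - a p.1)).card < M) :
    n ^ 2 < M + betaC k := by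
  obtain ⟨a, b, hab⟩ := Nat.sInf_mem
    (s := {m | ∃ (a : Fin n → ZMod d) (b : Fin n → ZMod d), numContr k a b = m})
    ⟨_, 0, 0, rfl⟩
  have hwin := h a b
  have hsplit := Finset.card_filter_add_card_filter_not (s := (Finset.univ : Finset (Fin n × Fin n)))
    (fun p => b p.2 = a p.1 + k p.1 p.2)
  have hcongr : (Finset.univ : Finset (Fin n × Fin n)).filter
      (fun p => k p.1 p.2 = b p.2 - a p.1) =
      Finset.univ.filter (fun p => b p.2 = a p.1 + k p.1 p.2) := by
    ext p
    simp only [Finset.mem_filter_univ, eq_sub_iff_add_eq']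
    exact eq_comm
  rw [hcongr] at hwin
  simp only [Finset.card_univ, Fintype.card_prod, Fintype.card_fin] at hsplit
  rw [betaC, ← hab, numContr, sq]
  simp only [ne_eq]
  omega

theorem one_le_one_sub_inv_mul_rpow {n s : ℕ} (hn : 4 ≤ n) (hs : 2 ≤ s) :
    1 ≤ (1 - 1 / (s : ℝ)) * (n : ℝ) ^ (1 / (s : ℝ)) := by
  have hs' : (2 : ℝ) ≤ s := by exact_mod_cast hs
  have hn' : (4 : ℝ) ≤ n := by exact_mod_cast hn
  have hbern := rpow_one_add_le_one_add_mul_self (s := -1 / 2) (p := 2 / (s : ℝ))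
    (by norm_num) (by positivity) (by rw [div_le_one (by linarith)]; exact hs')
  have hquarter : (1 + -1 / 2 : ℝ) ^ (2 / (s : ℝ)) = (1 / 4 : ℝ) ^ (1 / (s : ℝ)) := by
    rw [show (1 / 4 : ℝ) = (1 + -1 / 2) ^ (2 : ℝ) by norm_num, ← Real.rpow_mul (by norm_num)]
    congr 1
    ring
  rw [hquarter, show 1 + 2 / (s : ℝ) * (-1 / 2) = 1 - 1 / s by ring] at hbern
  have hnonneg : 0 ≤ 1 - 1 / (s : ℝ) := hbern.trans' (by positivity)
  calc (1 : ℝ) = (1 / 4 * 4 : ℝ) ^ (1 / (s : ℝ)) := by norm_num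
    _ = (1 / 4 : ℝ) ^ (1 / (s : ℝ)) * 4 ^ (1 / (s : ℝ)) :=
      Real.mul_rpow (by norm_num) (by norm_num)
    _ ≤ (1 - 1 / (s : ℝ)) * (n : ℝ) ^ (1 / (s : ℝ)) := by
      gcongr

theorem sq_lt_or_le_mul_sub {n s M : ℕ} (hn : 2 ≤ n) (hs : 2 ≤ s) (hsn : s ≤ n)
    (hM : 2 * (n : ℝ) ^ ((1 : ℝ) + 1 / (s : ℝ)) < M) :
    n ^ 2 < M ∨ M ≤ s * (M - 2 * n) := by
  have hn0 : (0 : ℝ) < n := by positivity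
  have hs0 : (0 : ℝ) < s := by positivity
  rcases lt_or_ge n 4 with h4 | h4
  · have hpow : 2 ^ s * n ^ (s + 1) < M ^ s := by
      have := pow_lt_pow_left₀ hM (by positivity) (show s ≠ 0 by omega)
      rw [mul_pow, ← Real.rpow_natCast (_ ^ _) s, ← Real.rpow_mul hn0.le,
        show (1 + 1 / (s : ℝ)) * s = ((s + 1 : ℕ) : ℝ) by push_cast; field_simp,
        Real.rpow_natCast] at this
      exact_mod_cast this
    by_contra! hcon
    have hM9 : M ≤ 9 := hcon.1.trans (by nlinarith)
    interval_cases n <;> interval_cases s <;> interval_cases M <;> omega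
  · right
    have key : (2 * n : ℝ) ≤ (1 - 1 / (s : ℝ)) * M := by
      have h1 := one_le_one_sub_inv_mul_rpow h4 hs
      have h2 : (0 : ℝ) ≤ 1 - 1 / (s : ℝ) := by
        rw [sub_nonneg, div_le_one hs0]
        exact_mod_cast (by omega : 1 ≤ s)
      rw [Real.rpow_add hn0, Real.rpow_one] at hM
      nlinarith [mul_le_mul_of_nonneg_left hM.le h2]
    have key' : (s : ℝ) * (2 * n) + M ≤ s * M := by
      have := mul_le_mul_of_nonneg_left key hs0.le
      have e : (s : ℝ) * ((1 - 1 / (s : ℝ)) * M) = s * M - M := by field_simp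
      linarith
    have key'' : s * (2 * n) + M ≤ s * M := by exact_mod_cast key'
    rw [Nat.mul_sub]
    omega

/-- For every `n ≥ 2` and `2 ≤ s ≤ n` there is a linear game on `n × n` inputs with at
most `(2sn²)^s` outputs whose classical value is at most `2·n^{−1+1/s}`. -/
theorem exists_game_low_classical_value {n s : ℕ} (hn : 2 ≤ n) (hs : 2 ≤ s) (hsn : s ≤ n) :
    ∃ d : ℕ, 1 ≤ d ∧ d ≤ (2 * s * n ^ 2) ^ s ∧
      ∃ k : Fin n → Fin n → ZMod d,
        ((n : ℝ) ^ 2 - (betaC k : ℝ) ≤ 2 * (n : ℝ) ^ ((1 : ℝ) + 1 / (s : ℝ))) ∧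
        (1 - (betaC k : ℝ) / (n : ℝ) ^ 2 ≤ 2 * (n : ℝ) ^ ((-1 : ℝ) + 1 / (s : ℝ))) := by
  have hn0 : (0 : ℝ) < n := by positivity
  have hn1 : (1 : ℝ) ≤ n := by exact_mod_cast (by omega : 1 ≤ n)
  set d := (2 * s * n ^ 2) ^ s with hd
  have hd0 : 0 < d := by positivity
  have : NeZero d := ⟨hd0.ne'⟩
  set M := ⌊2 * (n : ℝ) ^ ((1 : ℝ) + 1 / (s : ℝ))⌋₊ + 1 with hMdef
  have hM : 2 * (n : ℝ) ^ ((1 : ℝ) + 1 / (s : ℝ)) < M := by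
    rw [hMdef]
    push_cast
    exact Nat.lt_floor_add_one _
  have h2n : 2 * n < M := by
    have hle : (n : ℝ) ≤ (n : ℝ) ^ ((1 : ℝ) + 1 / (s : ℝ)) :=
      Real.self_le_rpow_of_one_le hn1 (by simp)
    exact_mod_cast (by linarith : 2 * (n : ℝ) < M)
  have hcount : (n ^ 2).choose M * d ^ (2 * n) < d ^ M := by
    rcases sq_lt_or_le_mul_sub hn hs hsn hM with h | h
    · rw [Nat.choose_eq_zero_of_lt h, zero_mul]
      positivity
    · rw [← Nat.sub_add_cancel h2n.le, pow_add, Nat.sub_add_cancel h2n.le]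
      refine Nat.mul_lt_mul_of_pos_right ?_ (by positivity)
      calc (n ^ 2).choose M ≤ (n ^ 2) ^ M := Nat.choose_le_pow _ _
        _ ≤ (n ^ 2) ^ (s * (M - 2 * n)) := Nat.pow_le_pow_right (by positivity) h
        _ < (2 * s * n ^ 2) ^ (s * (M - 2 * n)) := by
          refine Nat.pow_lt_pow_left ?_ (Nat.mul_ne_zero (by omega) (by omega))
          nlinarith [show 0 < n ^ 2 by positivity]
        _ = d ^ (M - 2 * n) := by rw [hd, pow_mul]
  obtain ⟨f, hf⟩ := exists_forall_card_agree_lt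
    (fun (t : (Fin n → ZMod d) × (Fin n → ZMod d)) (p : Fin n × Fin n) => t.2 p.2 - t.1 p.1) M (by
      simpa [ZMod.card, ← sq, ← pow_mul, mul_comm n 2] using hcount)
  have hβ := sq_lt_add_betaC (fun x y => f (x, y)) (fun a b => hf (a, b))
  have hmain : (n : ℝ) ^ 2 - (betaC (fun x y => f (x, y)) : ℝ) ≤
      2 * (n : ℝ) ^ ((1 : ℝ) + 1 / (s : ℝ)) := by
    have hle : n ^ 2 ≤ ⌊2 * (n : ℝ) ^ ((1 : ℝ) + 1 / (s : ℝ))⌋₊ +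
        betaC (fun x y => f (x, y)) := by omega
    have hle' : (n : ℝ) ^ 2 ≤ (⌊2 * (n : ℝ) ^ ((1 : ℝ) + 1 / (s : ℝ))⌋₊ : ℝ) +
        (betaC (fun x y => f (x, y)) : ℝ) := by exact_mod_cast hle
    linarith [Nat.floor_le (show 0 ≤ 2 * (n : ℝ) ^ ((1 : ℝ) + 1 / (s : ℝ)) by positivity)]
  refine ⟨d, hd0, le_rfl, fun x y => f (x, y), hmain, ?_⟩
  have hexp : (n : ℝ) ^ ((1 : ℝ) + 1 / (s : ℝ)) =
      (n : ℝ) ^ ((-1 : ℝ) + 1 / (s : ℝ)) * (n : ℝ) ^ 2 := by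
    rw [← Real.rpow_natCast, ← Real.rpow_add hn0]
    congr 1
    push_cast
    ring
  rw [hexp, ← mul_assoc, ← div_le_iff₀ (by positivity), sub_div, div_self (by positivity)] at hmain
  exact hmain
end

section
/- For every n ≥ 2 there exist a number of outputs d with 1 ≤ d ≤ 2^n·n^{3n} and a game matrix k : Fin n → Fin n → ZMod d attaining the maximal contradiction number β_C(k) = (n − 1)²; equivalently, its classical value is p_Cl(k) = (2n − 1)/n². -/
/-- If `g ∘ f` is constant on `S` while `f` is injective on `S`, then passing from the partition
defined by `g ∘ f` to the one defined by `f` creates at least `#S - 1` new classes. -/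
theorem card_image_comp_add_card_le {α β γ : Type*} [Fintype α] [DecidableEq β] [DecidableEq γ]
    (f : α → β) (g : β → γ) (S : Finset α) (hf : Set.InjOn f S)
    (hg : ∀ x ∈ S, ∀ y ∈ S, g (f x) = g (f y)) :
    (Finset.univ.image (g ∘ f)).card + S.card ≤ (Finset.univ.image f).card + 1 := by
  rcases S.eq_empty_or_nonempty with rfl | ⟨s, hs⟩
  · rw [← Finset.image_image]
    simpa using Finset.card_image_le.trans (Nat.le_succ _)
  · have hsub : Finset.univ.image (g ∘ f) ⊆
        insert (g (f s)) ((Finset.univ.image f \ S.image f).image g) := by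
      intro c hc
      obtain ⟨x, -, rfl⟩ := Finset.mem_image.1 hc
      rw [Finset.mem_insert]
      by_cases hx : f x ∈ S.image f
      · obtain ⟨z, hz, hzx⟩ := Finset.mem_image.1 hx
        exact Or.inl (by rw [Function.comp_apply, ← hzx]; exact hg z hz s hs)
      · exact Or.inr (Finset.mem_image.2 ⟨f x, by simpa using hx, rfl⟩)
    have h₁ := (Finset.card_le_card hsub).trans (Finset.card_insert_le _ _)
    have h₂ := Finset.card_image_le (s := Finset.univ.image f \ S.image f) (f := g)
    have h₃ := Finset.card_sdiff_add_card_eq_card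
      (Finset.image_subset_image (f := f) (Finset.subset_univ S))
    rw [Finset.card_image_of_injOn hf] at h₃
    omega

/-- The game with `n` inputs on each side and `n ^ n` outputs given by the matrix `x * n ^ y`. -/
def powGame (n : ℕ) : Fin n → Fin n → ZMod (n ^ n) :=
  fun x y => ((x * n ^ (y : ℕ) : ℕ) : ZMod (n ^ n))

/-- The set of inputs `x` for which the strategy `(a, b)` has no contradiction at `(x, y)`. -/
def agreements {nA nB d : ℕ} (k : Fin nA → Fin nB → ZMod d)
    (a : Fin nA → ZMod d) (b : Fin nB → ZMod d) (y : Fin nB) : Finset (Fin nA) :=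
  Finset.univ.filter fun x => b y = a x + k x y

theorem sum_card_agreements_add_numContr {nA nB d : ℕ} (k : Fin nA → Fin nB → ZMod d)
    (a : Fin nA → ZMod d) (b : Fin nB → ZMod d) :
    ∑ y, (agreements k a b y).card + numContr k a b = nA * nB := by
  have h : ∑ y, (agreements k a b y).card =
      ((Finset.univ : Finset (Fin nA × Fin nB)).filter
        (fun p => b p.2 = a p.1 + k p.1 p.2)).card := by
    simp only [agreements, Finset.card_filter]
    rw [Fintype.sum_prod_type_right]
  rw [h, numContr, Finset.card_filter_add_card_filter_not]
  simp

theorem val_modEq_of_mem_agreements {n : ℕ} [NeZero n] {a b : Fin n → ZMod (n ^ n)} {x z y : Fin n}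
    (hx : x ∈ agreements (powGame n) a b y) (hz : z ∈ agreements (powGame n) a b y) :
    (a x).val + x * n ^ (y : ℕ) ≡ (a z).val + z * n ^ (y : ℕ) [MOD n ^ n] := by
  rw [agreements, Finset.mem_filter] at hx hz
  rw [← ZMod.natCast_eq_natCast_iff]
  have h := hx.2.symm.trans hz.2
  simpa [powGame] using h

theorem card_image_mod_add_card_agreements_le {n : ℕ} [NeZero n] (a b : Fin n → ZMod (n ^ n))
    (y : Fin n) :
    (Finset.univ.image fun x => (a x).val % n ^ (y : ℕ)).card +
        (agreements (powGame n) a b y).card ≤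
      (Finset.univ.image fun x => (a x).val % n ^ ((y : ℕ) + 1)).card + 1 := by
  have hn : 0 < n := Nat.pos_of_neZero n
  have hcomp : (fun x => (a x).val % n ^ (y : ℕ)) =
      (fun t => t % n ^ (y : ℕ)) ∘ fun x => (a x).val % n ^ ((y : ℕ) + 1) := by
    funext x
    exact (Nat.mod_mod_of_dvd _ (pow_dvd_pow n (Nat.le_succ _))).symm
  rw [hcomp]
  apply card_image_comp_add_card_le
  · intro x hx z hz hxz
    have h := (val_modEq_of_mem_agreements hx hz).of_dvd (pow_dvd_pow n (Nat.succ_le_of_lt y.2))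
    have h₁ : (x : ℕ) * n ^ (y : ℕ) ≡ z * n ^ (y : ℕ) [MOD n ^ ((y : ℕ) + 1)] :=
      Nat.ModEq.add_left_cancel hxz h
    rw [pow_succ', Nat.ModEq, Nat.mul_mod_mul_right, Nat.mul_mod_mul_right,
      Nat.mod_eq_of_lt x.2, Nat.mod_eq_of_lt z.2] at h₁
    exact Fin.ext (Nat.eq_of_mul_eq_mul_right (pow_pos hn _) h₁)
  · intro x hx z hz
    have h := (val_modEq_of_mem_agreements hx hz).of_dvd (pow_dvd_pow n y.2.le)
    simp only [Nat.mod_mod_of_dvd _ (pow_dvd_pow n (Nat.le_succ (y : ℕ)))]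
    simpa [Nat.ModEq] using h

theorem sum_card_agreements_powGame_lt {n : ℕ} [NeZero n] (a b : Fin n → ZMod (n ^ n)) :
    ∑ y, (agreements (powGame n) a b y).card < 2 * n := by
  have hstep := Finset.sum_le_sum fun y (_ : y ∈ Finset.univ) =>
    card_image_mod_add_card_agreements_le a b y
  set c : ℕ → ℕ := fun i => (Finset.univ.image fun x => (a x).val % n ^ i).card with hc
  have htel : ∑ y : Fin n, c (y + 1) + c 0 = ∑ y : Fin n, c y + c n := by
    rw [Fin.sum_univ_eq_sum_range, Fin.sum_univ_eq_sum_range (fun i => c (i + 1)),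
      ← Finset.sum_range_succ', Finset.sum_range_succ]
  have hpos : 0 < c 0 := Finset.card_pos.2 (Finset.univ_nonempty.image _)
  have hle : c n ≤ n := Finset.card_image_le.trans (Finset.card_fin n).le
  simp only [Finset.sum_add_distrib, Finset.sum_const, Finset.card_univ, Fintype.card_fin,
    smul_eq_mul, mul_one] at hstep
  change ∑ y : Fin n, c y + _ ≤ ∑ y : Fin n, c (y + 1) + n at hstep
  omega

theorem exists_numContr_le_sq {m d : ℕ} (k : Fin (m + 1) → Fin (m + 1) → ZMod d) :
    ∃ a b, numContr k a b ≤ m ^ 2 := by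
  refine ⟨fun x => k 0 0 - k x 0, fun y => k 0 y, ?_⟩
  have hsub : (Finset.univ : Finset (Fin (m + 1) × Fin (m + 1))).filter
      (fun p => k 0 p.2 ≠ k 0 0 - k p.1 0 + k p.1 p.2) ⊆
      Finset.univ.erase 0 ×ˢ Finset.univ.erase 0 := by
    rintro ⟨x, y⟩ h
    simp only [Finset.mem_filter, Finset.mem_univ, true_and] at h
    simp only [Finset.mem_product, Finset.mem_erase, Finset.mem_univ, and_true]
    constructor <;> rintro rfl <;> simp at h
  refine (Finset.card_le_card hsub).trans ?_
  simp [sq]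

theorem betaC_powGame {n : ℕ} (hn : n ≠ 0) : betaC (powGame n) = (n - 1) ^ 2 := by
  obtain ⟨m, rfl⟩ := Nat.exists_eq_succ_of_ne_zero hn
  apply le_antisymm
  · obtain ⟨a, b, h⟩ := exists_numContr_le_sq (powGame (m + 1))
    exact le_trans (Nat.sInf_le ⟨a, b, rfl⟩) h
  · refine le_csInf ⟨_, 0, 0, rfl⟩ ?_
    rintro _ ⟨a, b, rfl⟩
    have h₁ := sum_card_agreements_add_numContr (powGame (m + 1)) a b
    have h₂ := sum_card_agreements_powGame_lt a b
    simp only [Nat.succ_eq_add_one, Nat.add_sub_cancel] at h₁ h₂ ⊢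
    nlinarith

/-- For every `n ≥ 2` there is a linear game on `n × n` inputs with at most `2^n·n^{3n}`
outputs attaining the maximal contradiction number `(n − 1)²`, i.e. whose classical value
is `(2n − 1)/n²`. -/
theorem exists_game_max_contradictions {n : ℕ} (hn : 2 ≤ n) :
    ∃ d : ℕ, 1 ≤ d ∧ d ≤ 2 ^ n * n ^ (3 * n) ∧
      ∃ k : Fin n → Fin n → ZMod d,
        betaC k = (n - 1) ^ 2 ∧
        1 - (betaC k : ℝ) / (n : ℝ) ^ 2 = (2 * (n : ℝ) - 1) / (n : ℝ) ^ 2 := by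
  refine ⟨n ^ n, Nat.one_le_pow _ _ (by omega), ?_, powGame n, betaC_powGame (by omega), ?_⟩
  · calc n ^ n ≤ n ^ (3 * n) := Nat.pow_le_pow_right (by omega) (by omega)
      _ ≤ 2 ^ n * n ^ (3 * n) := Nat.le_mul_of_pos_left _ (by positivity)
  · have hn₀ : (n : ℝ) ≠ 0 := by
      rw [Nat.cast_ne_zero]
      omega
    rw [betaC_powGame (by omega), Nat.cast_pow, Nat.cast_sub (by omega)]
    field_simp
    push_cast
    ring
end

section
/- Let n_A, n_B ≥ 2, let N = (n_A − 1)(n_B − 1), and let d = 2^{N+1}. Define the game matrix k : Fin n_A → Fin n_B → ZMod d by k(i,j) = 0 if i = 0 or j = 0, and k(i,j) = 2^{(i−1)(n_B−1) + (j−1)} (as an element of ZMod d) for i ≥ 1 and j ≥ 1 (so the nonzero entries are the distinct powers 2^0, 2^1, …, 2^{N−1}). Then β_C(k) = (n_A − 1)(n_B − 1), the maximal possible contradiction number. -/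
open Finset

/-- A level set of `g ∘ a`, `g ∘ b` separates at most one cell of the support of `c`. -/
lemma eq_zero_of_unique_mismatch {α β R : Type*} [Fintype α] [Fintype β]
    {c : α × β → ℚ} (hrow : ∀ x, ∑ y, c (x, y) = 0) (hcol : ∀ y, ∑ x, c (x, y) = 0)
    (f : α → R) (g : β → R) (p : α × β) (hp : f p.1 ≠ g p.2)
    (h : ∀ q, q ≠ p → c q ≠ 0 → f q.1 = g q.2) : c p = 0 := by
  classical
  let u : R → ℚ := fun z => if z = f p.1 then 1 else 0
  have hsum : ∑ q : α × β, c q * (u (f q.1) - u (g q.2)) = 0 := by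
    simp only [mul_sub, sum_sub_distrib]
    rw [Fintype.sum_prod_type, Fintype.sum_prod_type_right]
    simp [← sum_mul, hrow, hcol]
  rw [sum_eq_single p] at hsum
  · simpa [u, hp.symm] using hsum
  · intro q _ hq
    by_cases hc : c q = 0
    · simp [hc]
    · simp [h q hq hc]
  · simp

/-- If no nonzero matrix with zero row and column sums vanishes on `s`, then `s` contains at
least `(|α| - 1) (|β| - 1)` cells. -/
lemma card_mul_card_add_one_le {α β : Type*} [Fintype α] [Fintype β] [Nonempty β]
    (s : Finset (α × β))
    (h : ∀ c : α × β → ℚ, (∀ x, ∑ y, c (x, y) = 0) → (∀ y, ∑ x, c (x, y) = 0) →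
      (∀ p ∈ s, c p = 0) → c = 0) :
    Fintype.card α * Fintype.card β + 1 ≤ Fintype.card α + Fintype.card β + #s := by
  let F : ((α × β → ℚ) × ℚ) →ₗ[ℚ] (α → ℚ) × (β → ℚ) × (s → ℚ) :=
    { toFun := fun v => (fun x => ∑ y, v.1 (x, y), fun y => ∑ x, v.1 (x, y) - v.2,
        fun p => v.1 p)
      map_add' := by
        intro v w
        ext <;> simp [sum_add_distrib]
        ring
      map_smul' := by
        intro r v
        ext <;> simp [mul_sum, mul_sub] }
  have hF : Function.Injective F := by
    rw [injective_iff_map_eq_zero]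
    rintro ⟨c, t⟩ hv
    have hrow : ∀ x, ∑ y, c (x, y) = 0 := fun x => congrFun (congrArg Prod.fst hv) x
    have hcol : ∀ y, ∑ x, c (x, y) = t := fun y =>
      sub_eq_zero.1 (congrFun (congrArg (fun w => w.2.1) hv) y)
    have hs : ∀ p ∈ s, c p = 0 := fun p hp =>
      congrFun (congrArg (fun w => w.2.2) hv) ⟨p, hp⟩
    have ht : t = 0 := by
      have := sum_comm (s := univ) (t := univ) (f := fun x y => c (x, y))
      simpa [hrow, hcol] using this
    subst ht
    simp [h c hrow hcol hs]
  have := LinearMap.finrank_le_finrank_of_injective hF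
  simp only [Module.finrank_prod, Module.finrank_fintype_fun_eq_card, Module.finrank_self,
    Fintype.card_prod, Fintype.card_coe] at this
  omega

/-- Reduced modulo `2 ^ (e + 1)`, the power `2 ^ e` survives. -/
lemma two_pow_ne_zero_zmod (e : ℕ) : (2 : ZMod (2 ^ (e + 1))) ^ e ≠ 0 := by
  intro h
  have h' : ((2 ^ e : ℕ) : ZMod (2 ^ (e + 1))) = 0 := by exact_mod_cast h
  rw [ZMod.natCast_eq_zero_iff, Nat.pow_dvd_pow_iff_le_right (by norm_num)] at h'
  omega

lemma two_pow_eq_zero_zmod {e e' : ℕ} (h : e < e') : (2 : ZMod (2 ^ (e + 1))) ^ e' = 0 := by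
  have h' : ((2 ^ e' : ℕ) : ZMod (2 ^ (e + 1))) = 0 := by
    rw [ZMod.natCast_eq_zero_iff]
    exact pow_dvd_pow 2 h
  exact_mod_cast h'

/-- The satisfied cells of a strategy for the powers-of-two game carry no nonzero matrix with
zero row and column sums. -/
lemma eq_zero_of_support_satisfied {m n N : ℕ} {k : Fin (m + 1) → Fin (n + 1) → ZMod (2 ^ N)}
    (e : Fin m × Fin n → ℕ) (he : Function.Injective e) (heN : ∀ p, e p < N)
    (hrow0 : ∀ j, k 0 j = 0) (hcol0 : ∀ i, k i 0 = 0)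
    (hk : ∀ i j, k i.succ j.succ = 2 ^ e (i, j))
    (a : Fin (m + 1) → ZMod (2 ^ N)) (b : Fin (n + 1) → ZMod (2 ^ N))
    (c : Fin (m + 1) × Fin (n + 1) → ℚ)
    (hrow : ∀ x, ∑ y, c (x, y) = 0) (hcol : ∀ y, ∑ x, c (x, y) = 0)
    (hc : ∀ p, c p ≠ 0 → b p.2 = a p.1 + k p.1 p.2) : c = 0 := by
  classical
  have hinner : ∀ i j, c (Fin.succ i, Fin.succ j) = 0 := by
    by_contra! hne
    obtain ⟨i₀, j₀, h₀⟩ := hne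
    let T : Finset (Fin m × Fin n) := {p | c (p.1.succ, p.2.succ) ≠ 0}
    obtain ⟨p, hpT, hmin⟩ := T.exists_min_image e ⟨(i₀, j₀), by simpa [T] using h₀⟩
    have hp : c (p.1.succ, p.2.succ) ≠ 0 := by simpa [T] using hpT
    let π : ZMod (2 ^ N) →+* ZMod (2 ^ (e p + 1)) :=
      ZMod.castHom (pow_dvd_pow 2 (heN p)) _
    refine hp (eq_zero_of_unique_mismatch hrow hcol (fun x => π (a x)) (fun y => π (b y)) _ ?_ ?_)
    · have := hc _ hp
      simpa [this, hk, map_ofNat π 2] using two_pow_ne_zero_zmod (e p)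
    · rintro ⟨x, y⟩ hq hcq
      have hxy := hc _ hcq
      suffices π (k x y) = 0 by simp [hxy, this]
      induction x using Fin.cases with
      | zero => simp [hrow0]
      | succ i =>
        induction y using Fin.cases with
        | zero => simp [hcol0]
        | succ j =>
          have hle := hmin (i, j) (by simpa [T] using hcq)
          have hne : e p ≠ e (i, j) := fun h => hq (by rw [he h])
          rw [hk, map_pow, map_ofNat]
          exact two_pow_eq_zero_zmod (lt_of_le_of_ne hle hne)
  have hleft : ∀ i, c (Fin.succ i, 0) = 0 := fun i => by
    simpa [Fin.sum_univ_succ, hinner] using hrow i.succ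
  have htop : ∀ j, c (0, Fin.succ j) = 0 := fun j => by
    simpa [Fin.sum_univ_succ, hinner] using hcol j.succ
  have hcorner : c (0, 0) = 0 := by
    simpa [Fin.sum_univ_succ, htop] using hrow 0
  ext ⟨x, y⟩
  induction x using Fin.cases with
  | zero =>
    induction y using Fin.cases with
    | zero => exact hcorner
    | succ j => exact htop j
  | succ i =>
    induction y using Fin.cases with
    | zero => exact hleft i
    | succ j => exact hinner i j

/-- A game matrix with zero first row and column has a strategy with at most
`m * n` contradictions. -/
lemma numContr_zero_le {m n d : ℕ} {k : Fin (m + 1) → Fin (n + 1) → ZMod d}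
    (hrow0 : ∀ j, k 0 j = 0) (hcol0 : ∀ i, k i 0 = 0) : numContr k 0 0 ≤ m * n := by
  calc numContr k 0 0
      ≤ #((univ.erase (0 : Fin (m + 1))) ×ˢ (univ.erase (0 : Fin (n + 1)))) := by
        refine card_le_card fun p hp => ?_
        rw [mem_filter] at hp
        simp only [mem_product, mem_erase, mem_univ, and_true]
        refine ⟨fun h => hp.2 ?_, fun h => hp.2 ?_⟩ <;> simp [h, hrow0, hcol0]
    _ = m * n := by simp [card_product]

/-- The explicit game matrix with `d = 2^{(n_A−1)(n_B−1)+1}` outputs, zero first row and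
column, and remaining entries the distinct powers of two, attains the maximal
contradiction number `(n_A − 1)(n_B − 1)`. -/
theorem powers_of_two_game_max_contradictions {nA nB : ℕ} (hA : 2 ≤ nA) (hB : 2 ≤ nB)
    (k : Fin nA → Fin nB → ZMod (2 ^ ((nA - 1) * (nB - 1) + 1)))
    (hk : ∀ (i : Fin nA) (j : Fin nB),
      k i j = if (i : ℕ) = 0 ∨ (j : ℕ) = 0 then 0
        else (2 : ZMod (2 ^ ((nA - 1) * (nB - 1) + 1))) ^
          (((i : ℕ) - 1) * (nB - 1) + ((j : ℕ) - 1))) :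
    betaC k = (nA - 1) * (nB - 1) := by
  obtain ⟨m, rfl⟩ : ∃ m, nA = m + 1 := ⟨nA - 1, by omega⟩
  obtain ⟨n, rfl⟩ : ∃ n, nB = n + 1 := ⟨nB - 1, by omega⟩
  change betaC k = m * n
  have hrow0 : ∀ j, k 0 j = 0 := fun j => by simp [hk]
  have hcol0 : ∀ i, k i 0 = 0 := fun i => by simp [hk]
  let e : Fin m × Fin n → ℕ := fun p => finProdFinEquiv (p.1, p.2)
  have he : Function.Injective e := Fin.val_injective.comp finProdFinEquiv.injective
  have hke : ∀ i j, k (Fin.succ i) (Fin.succ j) = 2 ^ e (i, j) := fun i j => by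
    simp [hk, e, finProdFinEquiv, mul_comm, add_comm]
  have hlower : ∀ a b, m * n ≤ numContr k a b := fun a b => by
    have := card_mul_card_add_one_le
      (univ.filter fun p : Fin (m + 1) × Fin (n + 1) => b p.2 ≠ a p.1 + k p.1 p.2)
      (fun c hrow hcol hc => eq_zero_of_support_satisfied e he
        (fun p => (finProdFinEquiv p).isLt.trans (Nat.lt_succ_self _)) hrow0 hcol0 hke a b c
        hrow hcol fun p hp => by
          by_contra hne
          exact hp (hc p (by simpa using hne)))
    simp only [Fintype.card_fin] at this
    unfold numContr
    linarith
  refine le_antisymm (le_trans (Nat.sInf_le ⟨0, 0, rfl⟩) (numContr_zero_le hrow0 hcol0)) ?_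
  refine le_csInf ⟨_, 0, 0, rfl⟩ ?_
  rintro _ ⟨a, b, rfl⟩
  exact hlower a b
end

section
/- Let k : Fin 3 → Fin 3 → ZMod d be a game matrix with all off-diagonal entries zero and diagonal entries x₀ = k(0,0), x₁ = k(1,1), x₂ = k(2,2). Then: (i) if x₀, x₁, x₂ are all nonzero and (x₁ = x₂ = −x₀, or x₀ = x₂ = −x₁, or x₀ = x₁ = −x₂), then β_C(k) = 2; (ii) if x₀, x₁, x₂ are all nonzero and none of these three conditions holds, then β_C(k) = 3; (iii) if at least one of x₀, x₁, x₂ is zero, then β_C(k) equals the number of nonzero diagonal entries. -/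
theorem le_betaC {nA nB d m : ℕ} {k : Fin nA → Fin nB → ZMod d}
    (h : ∀ a b, m ≤ numContr k a b) : m ≤ betaC k := by
  refine le_csInf ⟨_, 0, 0, rfl⟩ ?_
  rintro _ ⟨a, b, rfl⟩
  exact h a b

theorem numContr_eq_sum {nA nB d : ℕ} (k : Fin nA → Fin nB → ZMod d)
    (a : Fin nA → ZMod d) (b : Fin nB → ZMod d) :
    numContr k a b = ∑ x, ∑ y, if b y ≠ a x + k x y then 1 else 0 := by
  rw [numContr, Finset.card_filter, Fintype.sum_prod_type]

/-- A rectangle whose alternating sum does not vanish contains a contradiction. -/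
theorem one_le_rectangle {nA nB d : ℕ} {k : Fin nA → Fin nB → ZMod d}
    (a : Fin nA → ZMod d) (b : Fin nB → ZMod d) {x x' : Fin nA} {y y' : Fin nB}
    (h : k x y + k x' y' ≠ k x y' + k x' y) :
    1 ≤ (if b y ≠ a x + k x y then 1 else 0) + (if b y' ≠ a x' + k x' y' then 1 else 0) +
      (if b y' ≠ a x + k x y' then 1 else 0) + (if b y ≠ a x' + k x' y then 1 else 0) := by
  by_contra hlt
  have hzero := Nat.lt_one_iff.mp (not_le.mp hlt)
  simp only [Nat.add_eq_zero_iff, ite_eq_right_iff, one_ne_zero, imp_false, not_not] at hzero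
  obtain ⟨⟨⟨h₁, h₂⟩, h₃⟩, h₄⟩ := hzero
  exact h (by linear_combination h₃ + h₄ - h₁ - h₂)

/-- The zero strategy has one contradiction for each nonzero diagonal entry. -/
theorem betaC_diag_le {n d : ℕ} {k : Fin n → Fin n → ZMod d}
    (hoff : ∀ i j, i ≠ j → k i j = 0) :
    betaC k ≤ (Finset.univ.filter fun i => k i i ≠ 0).card := by
  refine (betaC_le_numContr k 0 0).trans_eq ?_
  rw [numContr_eq_sum, Finset.card_filter]
  refine Finset.sum_congr rfl fun i _ => ?_
  rw [Finset.sum_eq_single i]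
  · simp [eq_comm]
  · intro j _ hj
    simp [hoff i j hj.symm]
  · simp

/-- Each nonzero diagonal entry of a `3 × 3` diagonal game matrix yields two rectangles
containing a contradiction. -/
theorem one_le_rectangle_of_diag {d : ℕ} {k : Fin 3 → Fin 3 → ZMod d}
    (hoff : ∀ i j : Fin 3, i ≠ j → k i j = 0) (a b : Fin 3 → ZMod d) {i j l : Fin 3}
    (hij : i ≠ j) (hil : i ≠ l) (hjl : j ≠ l) (hi : k i i ≠ 0) :
    1 ≤ (if b i ≠ a i + k i i then 1 else 0) + (if b l ≠ a j + k j l then 1 else 0) +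
      (if b l ≠ a i + k i l then 1 else 0) + (if b i ≠ a j + k j i then 1 else 0) :=
  one_le_rectangle a b (by simpa [hoff _ _ hjl, hoff _ _ hil, hoff _ _ hij.symm] using hi)

theorem one_le_principal_rectangle {d : ℕ} {k : Fin 3 → Fin 3 → ZMod d}
    (hoff : ∀ i j : Fin 3, i ≠ j → k i j = 0) (a b : Fin 3 → ZMod d) {i j : Fin 3}
    (hij : i ≠ j) (h : k i i + k j j ≠ 0) :
    1 ≤ (if b i ≠ a i + k i i then 1 else 0) + (if b j ≠ a j + k j j then 1 else 0) +
      (if b j ≠ a i + k i j then 1 else 0) + (if b i ≠ a j + k j i then 1 else 0) :=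
  one_le_rectangle a b (by simpa [hoff _ _ hij, hoff _ _ hij.symm] using h)

theorem sum_eq_of_pairwise_ne {M : Type*} [AddCommMonoid M] (f : Fin 3 → M) {i j l : Fin 3}
    (hij : i ≠ j) (hil : i ≠ l) (hjl : j ≠ l) : ∑ x, f x = f i + f j + f l := by
  have huniv : (Finset.univ : Finset (Fin 3)) = {i, j, l} := by decide +revert
  rw [huniv, Finset.sum_insert (by simp [hij, hil]), Finset.sum_pair hjl, add_assoc]

theorem one_le_numContr_of_diag {d : ℕ} {k : Fin 3 → Fin 3 → ZMod d}
    (hoff : ∀ i j : Fin 3, i ≠ j → k i j = 0) (a b : Fin 3 → ZMod d) {i j l : Fin 3}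
    (hij : i ≠ j) (hil : i ≠ l) (hjl : j ≠ l) (hi : k i i ≠ 0) : 1 ≤ numContr k a b := by
  have h₁ := one_le_rectangle_of_diag hoff a b hij hil hjl hi
  simp only [numContr_eq_sum, sum_eq_of_pairwise_ne _ hij hil hjl]
  omega

theorem two_le_numContr_of_diag {d : ℕ} {k : Fin 3 → Fin 3 → ZMod d}
    (hoff : ∀ i j : Fin 3, i ≠ j → k i j = 0) (a b : Fin 3 → ZMod d) {i j l : Fin 3}
    (hij : i ≠ j) (hil : i ≠ l) (hjl : j ≠ l) (hi : k i i ≠ 0) (hj : k j j ≠ 0) :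
    2 ≤ numContr k a b := by
  have h₁ := one_le_rectangle_of_diag hoff a b hij hil hjl hi
  have h₂ := one_le_rectangle_of_diag hoff a b hil hij hjl.symm hi
  have h₃ := one_le_rectangle_of_diag hoff a b hij.symm hjl hil hj
  have h₄ := one_le_rectangle_of_diag hoff a b hjl hij.symm hil.symm hj
  simp only [numContr_eq_sum, sum_eq_of_pairwise_ne _ hij hil hjl]
  omega

theorem three_le_numContr_of_diag {d : ℕ} {k : Fin 3 → Fin 3 → ZMod d}
    (hoff : ∀ i j : Fin 3, i ≠ j → k i j = 0) (a b : Fin 3 → ZMod d)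
    (h0 : k 0 0 ≠ 0) (h1 : k 1 1 ≠ 0) (h2 : k 2 2 ≠ 0)
    (h : ¬ ((k 1 1 = -k 0 0 ∧ k 2 2 = -k 0 0) ∨
        (k 0 0 = -k 1 1 ∧ k 2 2 = -k 1 1) ∨
        (k 0 0 = -k 2 2 ∧ k 1 1 = -k 2 2))) : 3 ≤ numContr k a b := by
  have hr := @one_le_rectangle_of_diag d k hoff a b
  have h₁ := hr (i := 0) (j := 1) (l := 2) (by decide) (by decide) (by decide) h0
  have h₂ := hr (i := 0) (j := 2) (l := 1) (by decide) (by decide) (by decide) h0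
  have h₃ := hr (i := 1) (j := 0) (l := 2) (by decide) (by decide) (by decide) h1
  have h₄ := hr (i := 1) (j := 2) (l := 0) (by decide) (by decide) (by decide) h1
  have h₅ := hr (i := 2) (j := 0) (l := 1) (by decide) (by decide) (by decide) h2
  have h₆ := hr (i := 2) (j := 1) (l := 0) (by decide) (by decide) (by decide) h2
  have hp := @one_le_principal_rectangle d k hoff a b
  have hcases : (k 0 0 + k 1 1 ≠ 0 ∧ k 0 0 + k 2 2 ≠ 0) ∨
      (k 0 0 + k 1 1 ≠ 0 ∧ k 1 1 + k 2 2 ≠ 0) ∨ (k 0 0 + k 2 2 ≠ 0 ∧ k 1 1 + k 2 2 ≠ 0) := by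
    grind
  rw [numContr_eq_sum]
  simp only [Fin.sum_univ_three]
  rcases hcases with ⟨ha, hb⟩ | ⟨ha, hb⟩ | ⟨ha, hb⟩
  · have hp₁ := hp (i := 0) (j := 1) (by decide) ha
    have hp₂ := hp (i := 0) (j := 2) (by decide) hb
    omega
  · have hp₁ := hp (i := 0) (j := 1) (by decide) ha
    have hp₂ := hp (i := 1) (j := 2) (by decide) hb
    omega
  · have hp₁ := hp (i := 0) (j := 2) (by decide) ha
    have hp₂ := hp (i := 1) (j := 2) (by decide) hb
    omega

/-- If two diagonal entries equal the negative of the third, two contradictions suffice. -/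
theorem betaC_le_two_of_diag {d : ℕ} {k : Fin 3 → Fin 3 → ZMod d}
    (hoff : ∀ i j : Fin 3, i ≠ j → k i j = 0) (i : Fin 3)
    (h : ∀ j, j ≠ i → k j j = -k i i) : betaC k ≤ 2 := by
  refine (betaC_le_numContr k (fun j => if j = i then 0 else k i i)
    (fun j => if j = i then k i i else 0)).trans ?_
  rw [numContr_eq_sum]
  fin_cases i <;> simp [Fin.sum_univ_three, hoff, h] <;> split_ifs <;> omega

/-- Contradiction numbers of `3 × 3` diagonal game matrices with diagonal entries
`x₀, x₁, x₂`: if all are nonzero then `β_C = 2` when one of them is the negative of the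
two (equal) others, and `β_C = 3` otherwise; if some diagonal entry is zero then `β_C`
equals the number of nonzero diagonal entries. -/
theorem betaC_diag3x3 {d : ℕ} (hd : 1 ≤ d) (k : Fin 3 → Fin 3 → ZMod d)
    (hoff : ∀ i j : Fin 3, i ≠ j → k i j = 0) :
    ((k 0 0 ≠ 0 ∧ k 1 1 ≠ 0 ∧ k 2 2 ≠ 0) →
      (((k 1 1 = -k 0 0 ∧ k 2 2 = -k 0 0) ∨
        (k 0 0 = -k 1 1 ∧ k 2 2 = -k 1 1) ∨
        (k 0 0 = -k 2 2 ∧ k 1 1 = -k 2 2)) → betaC k = 2) ∧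
      (¬ ((k 1 1 = -k 0 0 ∧ k 2 2 = -k 0 0) ∨
        (k 0 0 = -k 1 1 ∧ k 2 2 = -k 1 1) ∨
        (k 0 0 = -k 2 2 ∧ k 1 1 = -k 2 2)) → betaC k = 3)) ∧
    ((k 0 0 = 0 ∨ k 1 1 = 0 ∨ k 2 2 = 0) →
      betaC k = ((Finset.univ : Finset (Fin 3)).filter (fun i => k i i ≠ 0)).card) := by
  refine ⟨fun ⟨h0, h1, h2⟩ => ⟨fun h => ?_, fun h => ?_⟩, fun h => ?_⟩
  · refine le_antisymm ?_ (le_betaC fun a b =>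
      two_le_numContr_of_diag hoff a b (i := 0) (j := 1) (l := 2)
        (by decide) (by decide) (by decide) h0 h1)
    rcases h with ⟨h, h'⟩ | ⟨h, h'⟩ | ⟨h, h'⟩
    · exact betaC_le_two_of_diag hoff 0 (by simp [Fin.forall_fin_succ, h, h'])
    · exact betaC_le_two_of_diag hoff 1 (by simp [Fin.forall_fin_succ, h, h'])
    · exact betaC_le_two_of_diag hoff 2 (by simp [Fin.forall_fin_succ, h, h'])
  · exact le_antisymm ((betaC_diag_le hoff).trans (Finset.card_le_univ _))
      (le_betaC fun a b => three_le_numContr_of_diag hoff a b h0 h1 h2 h)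
  · refine le_antisymm (betaC_diag_le hoff) (le_betaC fun a b => ?_)
    have h01 := two_le_numContr_of_diag hoff a b (i := 0) (j := 1) (l := 2)
      (by decide) (by decide) (by decide)
    have h02 := two_le_numContr_of_diag hoff a b (i := 0) (j := 2) (l := 1)
      (by decide) (by decide) (by decide)
    have h12 := two_le_numContr_of_diag hoff a b (i := 1) (j := 2) (l := 0)
      (by decide) (by decide) (by decide)
    have h0 := one_le_numContr_of_diag hoff a b (i := 0) (j := 1) (l := 2)
      (by decide) (by decide) (by decide)
    have h1 := one_le_numContr_of_diag hoff a b (i := 1) (j := 0) (l := 2)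
      (by decide) (by decide) (by decide)
    have h2 := one_le_numContr_of_diag hoff a b (i := 2) (j := 0) (l := 1)
      (by decide) (by decide) (by decide)
    rw [Finset.card_filter, Fin.sum_univ_three]
    grind
end
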